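/- Fix N ≥ 1, 0 < b < min{2,N}, p > 1, and let u be a classical Schwartz solution of (INLS) on an interval J. Let φ : ℝ^N → ℝ be a radial function of class C⁴, φ(x) = w(|x|) with w : [0,∞) → ℝ, such that each partial derivative of φ of order ≤ 4 is bounded by C(1+|x|)^m for some constants C, m. Then, writing r = |x|, I(t) = ∫ φ|u(t,·)|² dx is twice differentiable on J with I''(t) = 4∫ (w'(r)/r)|∇ₓu(t,x)|² dx + 4∫ (w''(r)/r² − w'(r)/r³)|x·∇ₓu(t,x)|² dx − (2(p−1)/(p+1)) ∫ [w''(r) + (N−1+2b/(p−1)) w'(r)/r] |x|^{-b} |u(t,x)|^{p+1} dx − ∫ Δ²φ(x) |u(t,x)|² dx. -/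

import Mathlib

open MeasureTheory Set
open scoped BigOperators

noncomputable section

/-- The Laplacian of a complex-valued function on `ℝ^N`, computed as the sum of the repeated
directional derivatives along the standard basis vectors. -/
def lap {N : ℕ} (f : EuclideanSpace ℝ (Fin N) → ℂ) (x : EuclideanSpace ℝ (Fin N)) : ℂ :=
  ∑ i : Fin N, fderiv ℝ (fun y => fderiv ℝ f y (EuclideanSpace.single i 1)) x
      (EuclideanSpace.single i 1)

/-- The squared euclidean norm `|∇f(x)|²` of the gradient of `f : ℝ^N → ℂ` at `x`. -/
def gradNormSq {N : ℕ} (f : EuclideanSpace ℝ (Fin N) → ℂ) (x : EuclideanSpace ℝ (Fin N)) : ℝ :=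
  ∑ i : Fin N, ‖fderiv ℝ f x (EuclideanSpace.single i 1)‖ ^ 2

/-- A classical Schwartz solution of the inhomogeneous nonlinear Schrödinger equation
`i ∂ₜ u + Δu + |x|^{-b} |u|^{p-1} u = 0` on a time interval `J`:
for each time `t` the spatial profile `u t` is a Schwartz function, `u` is jointly
continuous on `J × ℝ^N`, jointly smooth on `J × (ℝ^N \ {0})`, the Schwartz seminorms of
`u t` are bounded uniformly for `t` in compact subsets of `J`, and the equation holds for
all `t ∈ J` and `x ≠ 0`. -/
structure INLSSolution (N : ℕ) (b p : ℝ) (J : Set ℝ) where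
  u : ℝ → SchwartzMap (EuclideanSpace ℝ (Fin N)) ℂ
  cont : ContinuousOn (fun q : ℝ × EuclideanSpace ℝ (Fin N) => u q.1 q.2) (J ×ˢ univ)
  smooth : ContDiffOn ℝ (⊤ : ℕ∞) (fun q : ℝ × EuclideanSpace ℝ (Fin N) => u q.1 q.2)
      (J ×ˢ {x : EuclideanSpace ℝ (Fin N) | x ≠ 0})
  seminorm_bound : ∀ K : Set ℝ, K ⊆ J → IsCompact K → ∀ k n : ℕ,
      ∃ C : ℝ, ∀ t ∈ K, SchwartzMap.seminorm ℝ k n (u t) ≤ C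
  eqn : ∀ t ∈ J, ∀ x : EuclideanSpace ℝ (Fin N), x ≠ 0 → ∃ ut' : ℂ,
      HasDerivWithinAt (fun s => u s x) ut' J t ∧
      Complex.I * ut' + lap (fun y => u t y) x +
        ((‖x‖ ^ (-b) * ‖u t x‖ ^ (p - 1) : ℝ) : ℂ) * u t x = 0

/-- The Laplacian of a real-valued function on `ℝ^N`, computed as the sum of the repeated
directional derivatives along the standard basis vectors. -/
def lapR {N : ℕ} (f : EuclideanSpace ℝ (Fin N) → ℝ) (x : EuclideanSpace ℝ (Fin N)) : ℝ :=
  ∑ i : Fin N, fderiv ℝ (fun y => fderiv ℝ f y (EuclideanSpace.single i 1)) x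
      (EuclideanSpace.single i 1)

/-- The virial functional `K(v) = ∫|∇v|² dx − ((N(p−1)+2b)/(2(p+1))) ∫ |x|^{-b}|v|^{p+1} dx`. -/
def Kq (N : ℕ) (b p : ℝ) (v : EuclideanSpace ℝ (Fin N) → ℂ) : ℝ :=
  (∫ x : EuclideanSpace ℝ (Fin N), gradNormSq v x) -
    (((N : ℝ) * (p - 1) + 2 * b) / (2 * (p + 1))) *
      ∫ x : EuclideanSpace ℝ (Fin N), ‖x‖ ^ (-b) * ‖v x‖ ^ (p + 1)

section Virial

open scoped SchwartzMap LineDeriv Topology ContDiff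
open Filter

variable {N : ℕ}

local notation "𝔼" => EuclideanSpace ℝ (Fin N)

/-- The `i`-th partial derivative of a function on `ℝ^N`. -/
def pd {F : Type*} [NormedAddCommGroup F] [NormedSpace ℝ F] (i : Fin N) (f : 𝔼 → F) (x : 𝔼) : F :=
  fderiv ℝ f x (EuclideanSpace.single i 1)

/-- The `i`-th partial derivative of a Schwartz function, as a Schwartz function. -/
def dS (i : Fin N) (v : 𝓢(𝔼, ℂ)) : 𝓢(𝔼, ℂ) := ∂_{(EuclideanSpace.single i (1 : ℝ) : 𝔼)} v


lemma lap_schwartz (v : 𝓢(𝔼, ℂ)) (x : 𝔼) : lap (v : 𝔼 → ℂ) x = ∑ i, dS i (dS i v) x := rfl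

lemma inner_complex (z w : ℂ) : inner ℝ z w = z.re * w.re + z.im * w.im := by
  rw [Complex.inner]; simp; ring

/-- Measurable functions of at most polynomial growth. -/
structure PolyBdd (g : 𝔼 → ℝ) : Prop where
  meas : Measurable g
  bound : ∃ (C : ℝ) (m : ℕ), 0 ≤ C ∧ ∀ x, |g x| ≤ C * (1 + ‖x‖) ^ m

/-- Measurable functions decaying rapidly at infinity, with at most a `|x|^{-b}` singularity. -/
structure Tame (b : ℝ) (h : 𝔼 → ℝ) : Prop where
  meas : Measurable h
  bound : ∀ k : ℕ, ∃ C : ℝ, 0 ≤ C ∧ ∀ x, |h x| * (1 + ‖x‖) ^ k ≤ C * (1 + ‖x‖ ^ (-b))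

lemma integrable_one_add_rpow_div {b : ℝ} (hb0 : 0 < b) (hb : b < N) :
    Integrable (fun x : 𝔼 => (1 + ‖x‖ ^ (-b)) * (1 + ‖x‖) ^ (-((N : ℝ) + 1))) := by
  have hN : 1 ≤ N := by
    rcases Nat.eq_zero_or_pos N with h | h
    · subst h; simp at hb; linarith
    · exact h
  have : NeZero N := ⟨by omega⟩
  have : Nontrivial 𝔼 := by
    have : Nonempty (Fin N) := ⟨0⟩
    infer_instance
  have h1 : Integrable (fun x : 𝔼 => (1 + ‖x‖) ^ (-((N : ℝ) + 1))) :=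
    integrable_one_add_norm (by simp)
  have hball : IntegrableOn (fun x : 𝔼 => ‖x‖ ^ (-b)) (Metric.ball 0 1) := by
    have := (integrableOn_fun_norm_addHaar (E := 𝔼) volume (f := fun y : ℝ => y ^ (-b))
      (r := 1)).2
    apply this
    have h2 : IntegrableOn (fun y : ℝ => y ^ ((N : ℝ) - 1 - b)) (Ioo 0 1) := by
      have := (intervalIntegral.intervalIntegrable_rpow' (a := 0) (b := 1)
        (r := (N : ℝ) - 1 - b) (by linarith))
      rw [intervalIntegrable_iff_integrableOn_Ioo_of_le zero_le_one] at this
      exact this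
    refine h2.congr_fun (fun y hy => ?_) measurableSet_Ioo
    simp only [finrank_euclideanSpace, Fintype.card_fin, smul_eq_mul]
    rw [← Real.rpow_natCast, ← Real.rpow_add hy.1, Nat.cast_sub hN]
    congr 1
    push_cast; ring
  have h3 : Integrable (fun x : 𝔼 => (Metric.ball (0 : 𝔼) 1).indicator (fun x => ‖x‖ ^ (-b)) x
      + 2 * (1 + ‖x‖) ^ (-((N : ℝ) + 1))) :=
    ((integrable_indicator_iff measurableSet_ball).2 hball).add (h1.const_mul 2)
  refine h3.mono' (Measurable.aestronglyMeasurable (by fun_prop)) (Eventually.of_forall fun x => ?_)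
  have h4 : 0 ≤ (1 + ‖x‖) ^ (-((N : ℝ) + 1)) := by positivity
  have h5 : 0 ≤ ‖x‖ ^ (-b) := by positivity
  have h6 : (1 + ‖x‖) ^ (-((N : ℝ) + 1)) ≤ 1 :=
    Real.rpow_le_one_of_one_le_of_nonpos (by linarith [norm_nonneg x]) (by linarith)
  rw [Real.norm_of_nonneg (by positivity)]
  by_cases hx : x ∈ Metric.ball (0 : 𝔼) 1
  · rw [indicator_of_mem hx]
    nlinarith
  · rw [indicator_of_notMem hx]
    have : ‖x‖ ^ (-b) ≤ 1 :=
      Real.rpow_le_one_of_one_le_of_nonpos (by simpa using hx) (by linarith)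
    nlinarith

lemma Tame.integrable {b : ℝ} (hb0 : 0 < b) (hb : b < N) {h : 𝔼 → ℝ} (hh : Tame b h) :
    Integrable h := by
  obtain ⟨C, hC, h1⟩ := hh.bound (N + 1)
  refine ((integrable_one_add_rpow_div hb0 hb).const_mul C).mono' hh.meas.aestronglyMeasurable
    (Eventually.of_forall fun x => ?_)
  have h2 : (1 + ‖x‖) ^ (-((N : ℝ) + 1)) = ((1 + ‖x‖) ^ (N + 1))⁻¹ := by
    rw [Real.rpow_neg (by positivity), ← Real.rpow_natCast]
    push_cast; rfl
  rw [h2, ← mul_assoc, ← div_eq_mul_inv, le_div_iff₀ (by positivity)]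
  exact h1 x

lemma Tame.add {b : ℝ} {f g : 𝔼 → ℝ} (hf : Tame b f) (hg : Tame b g) :
    Tame b (fun x => f x + g x) := by
  refine ⟨hf.meas.add hg.meas, fun k => ?_⟩
  obtain ⟨C, hC, h1⟩ := hf.bound k
  obtain ⟨D, hD, h2⟩ := hg.bound k
  refine ⟨C + D, by positivity, fun x => ?_⟩
  have := mul_le_mul_of_nonneg_right (abs_add_le (f x) (g x))
    (show 0 ≤ (1 + ‖x‖) ^ k by positivity)
  linarith [h1 x, h2 x]

lemma Tame.polyMul {b : ℝ} {f g : 𝔼 → ℝ} (hg : PolyBdd g) (hf : Tame b f) :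
    Tame b (fun x => g x * f x) := by
  refine ⟨hg.meas.mul hf.meas, fun k => ?_⟩
  obtain ⟨D, m, hD, h2⟩ := hg.bound
  obtain ⟨C, hC, h1⟩ := hf.bound (m + k)
  refine ⟨D * C, by positivity, fun x => ?_⟩
  calc |g x * f x| * (1 + ‖x‖) ^ k
      ≤ (D * (1 + ‖x‖) ^ m) * |f x| * (1 + ‖x‖) ^ k := by
        rw [abs_mul]; gcongr; exact h2 x
    _ = D * (|f x| * (1 + ‖x‖) ^ (m + k)) := by ring
    _ ≤ D * (C * (1 + ‖x‖ ^ (-b))) := mul_le_mul_of_nonneg_left (h1 x) hD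
    _ = _ := by ring

lemma PolyBdd.const (c : ℝ) : PolyBdd (fun _ : 𝔼 => c) :=
  ⟨measurable_const, |c|, 0, abs_nonneg c, by simp⟩

lemma PolyBdd.add {f g : 𝔼 → ℝ} (hf : PolyBdd f) (hg : PolyBdd g) :
    PolyBdd (fun x => f x + g x) := by
  obtain ⟨C, m, hC, h1⟩ := hf.bound
  obtain ⟨D, n, hD, h2⟩ := hg.bound
  refine ⟨hf.meas.add hg.meas, C + D, m + n, by positivity, fun x => ?_⟩
  have hx : 1 ≤ 1 + ‖x‖ := by linarith [norm_nonneg x]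
  have e1 : (1 + ‖x‖) ^ m ≤ (1 + ‖x‖) ^ (m + n) := pow_le_pow_right₀ hx (by omega)
  have e2 : (1 + ‖x‖) ^ n ≤ (1 + ‖x‖) ^ (m + n) := pow_le_pow_right₀ hx (by omega)
  calc |f x + g x| ≤ |f x| + |g x| := abs_add_le _ _
    _ ≤ C * (1 + ‖x‖) ^ m + D * (1 + ‖x‖) ^ n := add_le_add (h1 x) (h2 x)
    _ ≤ C * (1 + ‖x‖) ^ (m + n) + D * (1 + ‖x‖) ^ (m + n) := by gcongr
    _ = _ := by ring

lemma PolyBdd.mul {f g : 𝔼 → ℝ} (hf : PolyBdd f) (hg : PolyBdd g) :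
    PolyBdd (fun x => f x * g x) := by
  obtain ⟨C, m, hC, h1⟩ := hf.bound
  obtain ⟨D, n, hD, h2⟩ := hg.bound
  refine ⟨hf.meas.mul hg.meas, C * D, m + n, by positivity, fun x => ?_⟩
  calc |f x * g x| = |f x| * |g x| := abs_mul _ _
    _ ≤ (C * (1 + ‖x‖) ^ m) * (D * (1 + ‖x‖) ^ n) :=
      mul_le_mul (h1 x) (h2 x) (abs_nonneg _) (by positivity)
    _ = _ := by ring

lemma PolyBdd.sum {ι : Type*} (s : Finset ι) {f : ι → 𝔼 → ℝ} (hf : ∀ i ∈ s, PolyBdd (f i)) :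
    PolyBdd (fun x => ∑ i ∈ s, f i x) := by
  classical
  induction s using Finset.induction_on with
  | empty => simpa using PolyBdd.const 0
  | insert a s ha ih =>
    simp only [Finset.sum_insert ha]
    exact (hf a (by simp)).add (ih fun i hi => hf i (by simp [hi]))

lemma Tame.constMul {b : ℝ} {f : 𝔼 → ℝ} (c : ℝ) (hf : Tame b f) : Tame b (fun x => c * f x) :=
  Tame.polyMul (PolyBdd.const c) hf

lemma Tame.sub {b : ℝ} {f g : 𝔼 → ℝ} (hf : Tame b f) (hg : Tame b g) :
    Tame b (fun x => f x - g x) := by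
  simpa [sub_eq_add_neg] using hf.add (hg.constMul (-1))

lemma Tame.sum {b : ℝ} {ι : Type*} (s : Finset ι) {f : ι → 𝔼 → ℝ} (hf : ∀ i ∈ s, Tame b (f i)) :
    Tame b (fun x => ∑ i ∈ s, f i x) := by
  classical
  induction s using Finset.induction_on with
  | empty =>
    simp only [Finset.sum_empty]
    exact ⟨measurable_const, fun k => ⟨0, le_rfl, by simp⟩⟩
  | insert a s ha ih =>
    simp only [Finset.sum_insert ha]
    exact (hf a (by simp)).add (ih fun i hi => hf i (by simp [hi]))

/-- A bound on the Schwartz seminorms gives a bound on the weighted derivatives. -/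
lemma weighted_bound_of_seminorm {𝒱 : Set 𝓢(𝔼, ℂ)}
    (h : ∀ k n : ℕ, ∃ C : ℝ, ∀ v ∈ 𝒱, SchwartzMap.seminorm ℝ k n v ≤ C) (k n : ℕ) :
    ∃ C : ℝ, 0 ≤ C ∧ ∀ v ∈ 𝒱, ∀ x, ‖iteratedFDeriv ℝ n v x‖ * (1 + ‖x‖) ^ k ≤ C := by
  obtain ⟨C0, h0⟩ := h 0 n
  obtain ⟨C1, h1⟩ := h k n
  refine ⟨2 ^ k * (|C0| + |C1|), by positivity, fun v hv x => ?_⟩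
  have e0 := (SchwartzMap.le_seminorm ℝ 0 n v x).trans (h0 v hv)
  have e1 := (SchwartzMap.le_seminorm ℝ k n v x).trans (h1 v hv)
  have e2 : (1 + ‖x‖) ^ k ≤ 2 ^ k * (1 + ‖x‖ ^ k) := by
    rcases le_total ‖x‖ 1 with hx | hx
    · calc (1 + ‖x‖) ^ k ≤ 2 ^ k := by gcongr; linarith
        _ ≤ 2 ^ k * (1 + ‖x‖ ^ k) := le_mul_of_one_le_right (by positivity)
          (by linarith [pow_nonneg (norm_nonneg x) k])
    · calc (1 + ‖x‖) ^ k ≤ (2 * ‖x‖) ^ k := by gcongr; linarith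
        _ = 2 ^ k * ‖x‖ ^ k := mul_pow _ _ _
        _ ≤ 2 ^ k * (1 + ‖x‖ ^ k) := by gcongr; linarith
  calc ‖iteratedFDeriv ℝ n v x‖ * (1 + ‖x‖) ^ k
      ≤ ‖iteratedFDeriv ℝ n v x‖ * (2 ^ k * (1 + ‖x‖ ^ k)) := by gcongr
    _ = 2 ^ k * (‖x‖ ^ 0 * ‖iteratedFDeriv ℝ n v x‖ + ‖x‖ ^ k * ‖iteratedFDeriv ℝ n v x‖) := by
      ring
    _ ≤ 2 ^ k * (|C0| + |C1|) := by
      gcongr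
      · exact e0.trans (le_abs_self _)
      · exact e1.trans (le_abs_self _)

lemma norm_dS_le (i : Fin N) (v : 𝓢(𝔼, ℂ)) (n : ℕ) (x : 𝔼) :
    ‖iteratedFDeriv ℝ n (dS i v) x‖ ≤ ‖iteratedFDeriv ℝ (n + 1) v x‖ := by
  rw [← norm_iteratedFDeriv_fderiv]
  have h : ContDiff ℝ n (fderiv ℝ (v : 𝔼 → ℂ)) :=
    (v.smooth (n + 1)).fderiv_right (m := n) le_rfl
  have := norm_iteratedFDeriv_clm_apply_const (𝕜 := ℝ) (n := n) (x := x)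
    (c := (EuclideanSpace.single i (1 : ℝ) : 𝔼)) h.contDiffAt le_rfl
  have e : (dS i v : 𝔼 → ℂ) = fun y => fderiv ℝ v y (EuclideanSpace.single i 1) := rfl
  rw [e]
  simpa using this

lemma schwartz_decay (v : 𝓢(𝔼, ℂ)) (k : ℕ) :
    ∃ C : ℝ, 0 ≤ C ∧ ∀ x, ‖v x‖ * (1 + ‖x‖) ^ k ≤ C := by
  obtain ⟨C, hC, h⟩ := weighted_bound_of_seminorm (𝒱 := {v})
    (fun k n => ⟨SchwartzMap.seminorm ℝ k n v, by simp⟩) k 0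
  exact ⟨C, hC, fun x => by simpa using h v rfl x⟩

lemma tame_inner (b : ℝ) (f h : 𝓢(𝔼, ℂ)) : Tame b (fun x => inner ℝ (f x) (h x)) := by
  refine ⟨(f.continuous.inner h.continuous).measurable, fun k => ?_⟩
  obtain ⟨C, hC, h1⟩ := schwartz_decay f k
  obtain ⟨D, hD, h2⟩ := schwartz_decay h 0
  refine ⟨C * D, by positivity, fun x => ?_⟩
  have h3 : 0 ≤ ‖x‖ ^ (-b) := by positivity
  calc |inner ℝ (f x) (h x)| * (1 + ‖x‖) ^ k ≤ (‖f x‖ * ‖h x‖) * (1 + ‖x‖) ^ k := by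
        gcongr; exact abs_real_inner_le_norm _ _
    _ = (‖f x‖ * (1 + ‖x‖) ^ k) * (‖h x‖ * (1 + ‖x‖) ^ 0) := by ring
    _ ≤ C * D := mul_le_mul (h1 x) (h2 x) (by positivity) hC
    _ ≤ C * D * (1 + ‖x‖ ^ (-b)) := le_mul_of_one_le_right (by positivity) (by linarith)

/-- The nonlinear potential densities built from Schwartz functions are tame. -/
lemma tame_rpow_mul {b p : ℝ} (hp : 1 < p) (v f h : 𝓢(𝔼, ℂ)) :
    Tame b (fun x => ‖x‖ ^ (-b) * (‖v x‖ ^ (p - 1) * inner ℝ (f x) (h x))) := by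
  obtain ⟨M, hM, hv⟩ := schwartz_decay v 0
  refine ⟨?_, fun k => ?_⟩
  · have := (f.continuous.inner (𝕜 := ℝ) h.continuous).measurable
    have hv := v.continuous.measurable
    fun_prop
  obtain ⟨C, hC, h1⟩ := schwartz_decay f k
  obtain ⟨D, hD, h2⟩ := schwartz_decay h 0
  refine ⟨M ^ (p - 1) * (C * D), by positivity, fun x => ?_⟩
  have h3 : 0 ≤ ‖x‖ ^ (-b) := by positivity
  have h4 : ‖v x‖ ^ (p - 1) ≤ M ^ (p - 1) :=
    Real.rpow_le_rpow (norm_nonneg _) (by simpa using hv x) (by linarith)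
  calc |‖x‖ ^ (-b) * (‖v x‖ ^ (p - 1) * inner ℝ (f x) (h x))| * (1 + ‖x‖) ^ k
      = ‖x‖ ^ (-b) * (‖v x‖ ^ (p - 1) * |inner ℝ (f x) (h x)|) * (1 + ‖x‖) ^ k := by
        rw [abs_mul, abs_mul, abs_of_nonneg h3, abs_of_nonneg (by positivity : 0 ≤ ‖v x‖ ^ (p - 1))]
    _ ≤ ‖x‖ ^ (-b) * (M ^ (p - 1) * (‖f x‖ * ‖h x‖)) * (1 + ‖x‖) ^ k := by
        gcongr; exact abs_real_inner_le_norm _ _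
    _ = ‖x‖ ^ (-b) * M ^ (p - 1) * ((‖f x‖ * (1 + ‖x‖) ^ k) * (‖h x‖ * (1 + ‖x‖) ^ 0)) := by ring
    _ ≤ ‖x‖ ^ (-b) * M ^ (p - 1) * (C * D) := by
        gcongr
        · exact h1 x
        · exact h2 x
    _ ≤ M ^ (p - 1) * (C * D) * (1 + ‖x‖ ^ (-b)) := by
        have : 0 ≤ M ^ (p - 1) * (C * D) := by positivity
        linarith

lemma integral_pd_eq_zero {F : 𝔼 → ℝ} (i : Fin N) (hF : Differentiable ℝ F) (h1 : Integrable F)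
    (h2 : Integrable (pd i F)) : ∫ x, pd i F x = 0 := by
  have := integral_mul_fderiv_eq_neg_fderiv_mul_of_integrable (𝕜 := ℝ) (μ := (volume : Measure 𝔼))
    (f := fun _ : 𝔼 => (1 : ℝ)) (g := F) (v := EuclideanSpace.single i 1)
    (by simp) (by simp only [one_mul]; exact h2) (by simpa using h1) (fun x _ => by fun_prop) (fun x _ => hF x)
  simpa [pd] using this

/-- Tame functions with vanishing integral. -/
structure Null (b : ℝ) (h : 𝔼 → ℝ) : Prop where
  tame : Tame b h
  integral : ∫ x, h x = 0

lemma Null.add {b : ℝ} (hb0 : 0 < b) (hb : b < N) {f g : 𝔼 → ℝ} (hf : Null b f) (hg : Null b g) :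
    Null b (fun x => f x + g x) :=
  ⟨hf.tame.add hg.tame, by
    rw [integral_add (hf.tame.integrable hb0 hb) (hg.tame.integrable hb0 hb), hf.integral,
      hg.integral, add_zero]⟩

lemma Null.constMul {b : ℝ} {f : 𝔼 → ℝ} (c : ℝ) (hf : Null b f) : Null b (fun x => c * f x) :=
  ⟨hf.tame.constMul c, by rw [integral_const_mul, hf.integral, mul_zero]⟩

lemma Null.sum {b : ℝ} (hb0 : 0 < b) (hb : b < N) {ι : Type*} (s : Finset ι) {f : ι → 𝔼 → ℝ}
    (hf : ∀ i ∈ s, Null b (f i)) : Null b (fun x => ∑ i ∈ s, f i x) :=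
  ⟨Tame.sum s fun i hi => (hf i hi).tame, by
    rw [integral_finsetSum s fun i hi => (hf i hi).tame.integrable hb0 hb]
    exact Finset.sum_eq_zero fun i hi => (hf i hi).integral⟩

lemma Null.integral_eq {b : ℝ} (hb0 : 0 < b) (hb : b < N) {f g h : 𝔼 → ℝ} (hh : Null b h)
    (hf : Tame b f) (hg : Tame b g) (e : ∀ x, f x - g x = h x) : ∫ x, f x = ∫ x, g x := by
  rw [← sub_eq_zero, ← integral_sub (hf.integrable hb0 hb) (hg.integrable hb0 hb)]
  simp_rw [e]
  exact hh.integral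

/-- `C^n` functions all of whose derivatives up to order `n` have polynomial growth. -/
def Moderate (n : ℕ) (g : 𝔼 → ℝ) : Prop :=
  ContDiff ℝ n g ∧ ∃ (C : ℝ) (m : ℕ), ∀ x, ∀ k ≤ n, ‖iteratedFDeriv ℝ k g x‖ ≤ C * (1 + ‖x‖) ^ m

lemma Moderate.polyBdd {n : ℕ} {g : 𝔼 → ℝ} (hg : Moderate n g) : PolyBdd g := by
  obtain ⟨h, C, m, hC⟩ := hg
  refine ⟨h.continuous.measurable, |C|, m, abs_nonneg C, fun x => ?_⟩
  have := hC x 0 (Nat.zero_le _)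
  rw [norm_iteratedFDeriv_zero, Real.norm_eq_abs] at this
  exact this.trans (by gcongr; exact le_abs_self C)

lemma Moderate.pd {n : ℕ} {g : 𝔼 → ℝ} (hg : Moderate (n + 1) g) (i : Fin N) :
    Moderate n (pd i g) := by
  obtain ⟨h, C, m, hC⟩ := hg
  have h' : ContDiff ℝ n (fderiv ℝ g) := h.fderiv_right (m := n) (by norm_cast)
  refine ⟨h'.clm_apply contDiff_const, C, m, fun x k hk => ?_⟩
  have h1 := norm_iteratedFDeriv_clm_apply_const (𝕜 := ℝ) (n := k) (x := x)
    (c := (EuclideanSpace.single i (1 : ℝ) : 𝔼)) h'.contDiffAt (by exact_mod_cast hk)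
  rw [norm_iteratedFDeriv_fderiv] at h1
  refine (h1.trans ?_).trans (hC x (k + 1) (by omega))
  simp

lemma Moderate.mono {n k : ℕ} {g : 𝔼 → ℝ} (hg : Moderate n g) (h : k ≤ n) : Moderate k g := by
  obtain ⟨h1, C, m, hC⟩ := hg
  exact ⟨h1.of_le (by exact_mod_cast h), C, m, fun x j hj => hC x j (hj.trans h)⟩

lemma Moderate.add {n : ℕ} {f g : 𝔼 → ℝ} (hf : Moderate n f) (hg : Moderate n g) :
    Moderate n (fun x => f x + g x) := by
  obtain ⟨h1, C, m, hC⟩ := hf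
  obtain ⟨h2, D, l, hD⟩ := hg
  refine ⟨h1.add h2, |C| + |D|, m + l, fun x k hk => ?_⟩
  have hk' : (k : ℕ∞ω) ≤ (n : ℕ∞ω) := by exact_mod_cast hk
  have := iteratedFDeriv_add_apply (𝕜 := ℝ) (i := k) (x := x) (f := f) (g := g)
    (h1.of_le hk').contDiffAt (h2.of_le hk').contDiffAt
  have e : (fun x => f x + g x) = f + g := rfl
  rw [e, this]
  have hx : 1 ≤ 1 + ‖x‖ := by linarith [norm_nonneg x]
  have e1 : (1 + ‖x‖) ^ m ≤ (1 + ‖x‖) ^ (m + l) := pow_le_pow_right₀ hx (by omega)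
  have e2 : (1 + ‖x‖) ^ l ≤ (1 + ‖x‖) ^ (m + l) := pow_le_pow_right₀ hx (by omega)
  calc _ ≤ ‖iteratedFDeriv ℝ k f x‖ + ‖iteratedFDeriv ℝ k g x‖ := norm_add_le _ _
    _ ≤ C * (1 + ‖x‖) ^ m + D * (1 + ‖x‖) ^ l := add_le_add (hC x k hk) (hD x k hk)
    _ ≤ |C| * (1 + ‖x‖) ^ (m + l) + |D| * (1 + ‖x‖) ^ (m + l) := by
      gcongr
      · exact le_abs_self C
      · exact le_abs_self D
    _ = _ := by ring

lemma Moderate.sum {n : ℕ} {ι : Type*} (s : Finset ι) {f : ι → 𝔼 → ℝ}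
    (hf : ∀ i ∈ s, Moderate n (f i)) : Moderate n (fun x => ∑ i ∈ s, f i x) := by
  classical
  induction s using Finset.induction_on with
  | empty =>
    simp only [Finset.sum_empty]
    exact ⟨contDiff_const, 0, 0, fun x k _ => by
      have : (fun _ : 𝔼 => (0 : ℝ)) = 0 := rfl
      simp [this]⟩
  | insert a s ha ih =>
    simp only [Finset.sum_insert ha]
    exact (hf a (by simp)).add (ih fun i hi => hf i (by simp [hi]))

lemma Moderate.lapR {n : ℕ} {g : 𝔼 → ℝ} (hg : Moderate (n + 2) g) : Moderate n (lapR g) :=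
  Moderate.sum Finset.univ fun i _ => (Moderate.pd (n := n + 1) hg i).pd i

lemma Moderate.differentiable {n : ℕ} {g : 𝔼 → ℝ} (hg : Moderate (n + 1) g) :
    Differentiable ℝ g :=
  hg.1.differentiable (by simp)

/-- The product rule for a weight times the inner product of two Schwartz functions, whose
integral vanishes. -/
def divTerm (i : Fin N) (g : 𝔼 → ℝ) (f h : 𝓢(𝔼, ℂ)) (x : 𝔼) : ℝ :=
  pd i g x * inner ℝ (f x) (h x) +
    (g x * inner ℝ (dS i f x) (h x) + g x * inner ℝ (f x) (dS i h x))

lemma null_divTerm {b : ℝ} (hb0 : 0 < b) (hb : b < N) (i : Fin N) {g : 𝔼 → ℝ} (hg : Moderate 1 g)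
    (f h : 𝓢(𝔼, ℂ)) : Null b (divTerm i g f h) := by
  have ht : Tame b (divTerm i g f h) :=
    (Tame.polyMul (hg.pd (n := 0) i).polyBdd (tame_inner b f h)).add
      ((Tame.polyMul hg.polyBdd (tame_inner b _ h)).add
        (Tame.polyMul hg.polyBdd (tame_inner b f _)))
  refine ⟨ht, ?_⟩
  have hd : ∀ x, HasFDerivAt (fun y => g y * inner ℝ (f y) (h y)) _ x := fun x =>
    (Moderate.differentiable (n := 0) hg x).hasFDerivAt.mul
      ((f.hasFDerivAt x).inner ℝ (h.hasFDerivAt x))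
  have e : pd i (fun y => g y * inner ℝ (f y) (h y)) = divTerm i g f h := by
    ext x
    rw [pd, (hd x).fderiv]
    simp only [divTerm, pd, dS, SchwartzMap.lineDerivOp_apply_eq_fderiv]
    simp
    ring
  rw [← e]
  exact integral_pd_eq_zero i (fun x => (hd x).differentiableAt)
    ((Tame.polyMul hg.polyBdd (tame_inner b f h)).integrable hb0 hb)
    (e ▸ ht.integrable hb0 hb)

/-- The symmetrised first order operator `∇φ·∇v + ½ Δφ v`. -/
def virialOp (φ : 𝔼 → ℝ) (v : 𝓢(𝔼, ℂ)) (x : 𝔼) : ℂ :=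
  ∑ k, ((pd k φ x : ℝ) : ℂ) * dS k v x + ((lapR φ x / 2 : ℝ) : ℂ) * v x

lemma inner_virialOp (φ : 𝔼 → ℝ) (z : ℂ) (v : 𝓢(𝔼, ℂ)) (x : 𝔼) :
    inner ℝ z (virialOp φ v x) = ∑ k, pd k φ x * inner ℝ z (dS k v x) +
      lapR φ x / 2 * inner ℝ z (v x) := by
  rw [virialOp, inner_add_right, inner_sum]
  congr 1
  · refine Finset.sum_congr rfl fun k _ => ?_
    simp only [inner_complex, Complex.re_ofReal_mul, Complex.im_ofReal_mul]; ring
  · simp only [inner_complex, Complex.re_ofReal_mul, Complex.im_ofReal_mul]; ring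

lemma dS_comm (j k : Fin N) (v : 𝓢(𝔼, ℂ)) : dS j (dS k v) = dS k (dS j v) := by
  ext x
  have h1 : ContDiff ℝ 2 (v : 𝔼 → ℂ) := v.smooth 2
  have h2 : Differentiable ℝ (fderiv ℝ (v : 𝔼 → ℂ)) :=
    (h1.fderiv_right (m := 1) (by norm_num)).differentiable (by norm_num)
  have h3 : IsSymmSndFDerivAt ℝ (v : 𝔼 → ℂ) x := h1.contDiffAt.isSymmSndFDerivAt (by simp)
  have h4 : ∀ a c : Fin N, dS a (dS c v) x =
      fderiv ℝ (fderiv ℝ v) x (EuclideanSpace.single a 1) (EuclideanSpace.single c 1) := by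
    intro a c
    change fderiv ℝ (fun y => fderiv ℝ v y (EuclideanSpace.single c 1)) x
      (EuclideanSpace.single a 1) = _
    rw [fderiv_clm_apply (h2 x) (by fun_prop)]
    simp
  rw [h4, h4, h3.eq]

lemma tame_inner_virialOp (b : ℝ) {φ : 𝔼 → ℝ} (hφ : Moderate 2 φ) (f v : 𝓢(𝔼, ℂ)) :
    Tame b (fun x => inner ℝ (f x) (virialOp φ v x)) := by
  simp_rw [inner_virialOp]
  refine (Tame.sum _ fun k _ => Tame.polyMul (hφ.pd k).polyBdd (tame_inner b f _)).add ?_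
  simp_rw [div_eq_mul_inv]
  exact Tame.polyMul ((Moderate.lapR (n := 0) hφ).polyBdd.mul (PolyBdd.const 2⁻¹))
    (tame_inner b f v)

lemma lap_eq_sum (v : 𝓢(𝔼, ℂ)) : (lap v : 𝔼 → ℂ) = (∑ i, dS i (dS i v) : 𝓢(𝔼, ℂ)) := by
  ext x; rw [lap_schwartz]; simp

lemma integral_inner_lap_virialOp {b : ℝ} (hb0 : 0 < b) (hb : b < N) {φ : 𝔼 → ℝ}
    (hφ : Moderate 4 φ) (v : 𝓢(𝔼, ℂ)) :
    ∫ x, (-4) * inner ℝ (lap v x) (virialOp φ v x) =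
      ∫ x, (4 * (∑ j, ∑ k, pd j (pd k φ) x * inner ℝ (dS j v x) (dS k v x)) -
        lapR (lapR φ) x * ‖v x‖ ^ 2) := by
  have hL := Moderate.lapR (n := 2) hφ
  have hn : Null b (fun x => ∑ j, (∑ k, ((-4) * divTerm j (pd k φ) (dS j v) (dS k v) x +
      2 * divTerm k (pd k φ) (dS j v) (dS j v) x) + ((-2) * divTerm j (lapR φ) (dS j v) v x +
      divTerm j (pd j (lapR φ)) v v x))) := by
    refine Null.sum hb0 hb _ fun j _ => Null.add hb0 hb (Null.sum hb0 hb _ fun k _ =>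
      Null.add hb0 hb (Null.constMul _ ?_) (Null.constMul _ ?_))
      (Null.add hb0 hb (Null.constMul _ ?_) ?_)
    · exact null_divTerm hb0 hb _ ((hφ.pd k).mono (by omega)) _ _
    · exact null_divTerm hb0 hb _ ((hφ.pd k).mono (by omega)) _ _
    · exact null_divTerm hb0 hb _ (hL.mono (by omega)) _ _
    · exact null_divTerm hb0 hb _ (hL.pd j) _ _
  refine hn.integral_eq hb0 hb ?_ ?_ ?_
  · rw [lap_eq_sum]
    exact (tame_inner_virialOp b (hφ.mono (by omega)) _ v).constMul _
  · simp_rw [← real_inner_self_eq_norm_sq]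
    exact ((Tame.sum _ fun j _ => Tame.sum _ fun k _ => Tame.polyMul
      (((hφ.pd k).pd j).polyBdd) (tame_inner b _ _)).constMul 4).sub
      (Tame.polyMul (Moderate.lapR (n := 0) hL).polyBdd (tame_inner b v v))
  · intro x
    rw [lap_schwartz, sum_inner]
    have e : lapR (lapR φ) x = ∑ j, pd j (pd j (lapR φ)) x := rfl
    rw [e, Finset.mul_sum, Finset.mul_sum, Finset.sum_mul, ← Finset.sum_sub_distrib,
      ← Finset.sum_sub_distrib]
    refine Finset.sum_congr rfl fun j _ => ?_
    have e2 : lapR φ x = ∑ k, pd k (pd k φ) x := rfl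
    have e3 : ∑ k, ((-4) * divTerm j (pd k φ) (dS j v) (dS k v) x +
        2 * divTerm k (pd k φ) (dS j v) (dS j v) x) =
        -4 * ∑ k, pd j (pd k φ) x * inner ℝ (dS j v x) (dS k v x)
        - 4 * ∑ k, pd k φ x * inner ℝ (dS j (dS j v) x) (dS k v x)
        + 2 * (lapR φ x * inner ℝ (dS j v x) (dS j v x)) := by
      rw [e2, Finset.sum_mul, Finset.mul_sum, Finset.mul_sum, Finset.mul_sum,
        ← Finset.sum_sub_distrib, ← Finset.sum_add_distrib]
      refine Finset.sum_congr rfl fun k _ => ?_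
      simp only [divTerm]
      rw [dS_comm j k, real_inner_comm (dS j v x) (dS k (dS j v) x)]
      ring
    rw [e3, inner_virialOp, ← real_inner_self_eq_norm_sq]
    simp only [divTerm]
    rw [real_inner_comm (v x) (dS j v x)]
    ring

lemma dS_smul (i : Fin N) (c : ℂ) (v : 𝓢(𝔼, ℂ)) : dS i (c • v) = c • dS i v :=
  LineDeriv.lineDerivOp_smul _ _ _

lemma inner_neg_two_I_mul (v : 𝓢(𝔼, ℂ)) (z : ℂ) (x : 𝔼) :
    inner ℝ (v x) (-2 * Complex.I * z) = inner ℝ (((2 * Complex.I) • v : 𝓢(𝔼, ℂ)) x) z := by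
  simp only [inner_complex, _root_.smul_apply, smul_eq_mul, Complex.mul_re, Complex.mul_im,
    Complex.neg_re, Complex.neg_im, Complex.I_re, Complex.I_im, Complex.re_ofNat, Complex.im_ofNat]
  ring

lemma virialOp_symm {b : ℝ} (hb0 : 0 < b) (hb : b < N) {φ : 𝔼 → ℝ} (hφ : Moderate 2 φ)
    (v w : 𝓢(𝔼, ℂ)) :
    ∫ x, inner ℝ (v x) (-2 * Complex.I * virialOp φ w x) =
      ∫ x, inner ℝ (w x) (-2 * Complex.I * virialOp φ v x) := by
  simp_rw [inner_neg_two_I_mul]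
  refine (Null.sum hb0 hb Finset.univ fun i _ => null_divTerm hb0 hb i (hφ.pd i)
    ((2 * Complex.I) • v) w).integral_eq hb0 hb (tame_inner_virialOp b hφ _ _)
    (tame_inner_virialOp b hφ _ _) fun x => ?_
  have h0 : lapR φ x = ∑ i, pd i (pd i φ) x := rfl
  rw [inner_virialOp, inner_virialOp, h0, Finset.sum_div, Finset.sum_mul, Finset.sum_mul,
    ← Finset.sum_add_distrib, ← Finset.sum_add_distrib, ← Finset.sum_sub_distrib]
  refine Finset.sum_congr rfl fun i _ => ?_
  rw [divTerm, dS_smul]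
  simp only [inner_complex, _root_.smul_apply, smul_eq_mul, Complex.mul_re, Complex.mul_im,
    Complex.I_re, Complex.I_im, Complex.re_ofNat, Complex.im_ofNat]
  ring

lemma integral_inner_I_lap {b : ℝ} (hb0 : 0 < b) (hb : b < N) {φ : 𝔼 → ℝ} (hφ : Moderate 2 φ)
    (v : 𝓢(𝔼, ℂ)) :
    ∫ x, 2 * (φ x * inner ℝ (Complex.I * lap v x) (v x)) =
      ∫ x, inner ℝ (v x) (-2 * Complex.I * virialOp φ v x) := by
  simp_rw [inner_neg_two_I_mul]
  refine (Null.sum hb0 hb Finset.univ fun i _ => (null_divTerm hb0 hb i (hφ.mono one_le_two)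
    (Complex.I • dS i v) v).constMul 2).integral_eq hb0 hb ?_
    (tame_inner_virialOp b hφ _ _) fun x => ?_
  · have h1 : ∀ x, Complex.I * lap v x = (Complex.I • ∑ i, dS i (dS i v) : 𝓢(𝔼, ℂ)) x := by
      intro x; rw [lap_eq_sum]; rfl
    simp_rw [h1]
    exact (Tame.polyMul hφ.polyBdd (tame_inner b _ _)).constMul 2
  · rw [inner_virialOp, lap_schwartz, Finset.mul_sum, sum_inner, Finset.mul_sum, Finset.mul_sum]
    have h0 : inner ℝ (((2 * Complex.I) • v : 𝓢(𝔼, ℂ)) x) (v x) = 0 := by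
      simp only [inner_complex, _root_.smul_apply, smul_eq_mul, Complex.mul_re, Complex.mul_im,
        Complex.I_re, Complex.I_im, Complex.re_ofNat, Complex.im_ofNat]
      ring
    rw [h0, mul_zero, add_zero, ← Finset.sum_sub_distrib]
    refine Finset.sum_congr rfl fun i _ => ?_
    rw [divTerm, dS_smul]
    simp only [inner_complex, _root_.smul_apply, smul_eq_mul, Complex.mul_re, Complex.mul_im,
      Complex.I_re, Complex.I_im, Complex.re_ofNat, Complex.im_ofNat]
    ring

lemma tame_norm_rpow_mul (b : ℝ) {p : ℝ} (hp : 1 < p) (v f h : 𝓢(𝔼, ℂ)) :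
    Tame b (fun x => ‖v x‖ ^ (p - 1) * inner ℝ (f x) (h x)) := by
  obtain ⟨M, hM, hv⟩ := schwartz_decay v 0
  have hm : Measurable fun x => ‖v x‖ ^ (p - 1) := by
    have hv := v.continuous.measurable
    fun_prop
  refine Tame.polyMul ⟨hm, M ^ (p - 1), 0, by positivity, fun x => ?_⟩ (tame_inner b f h)
  rw [abs_of_nonneg (by positivity)]
  have h4 : ‖v x‖ ^ (p - 1) ≤ M ^ (p - 1) :=
    Real.rpow_le_rpow (norm_nonneg _) (by simpa using hv x) (by linarith)
  simpa using h4

lemma Tame.abs {b : ℝ} {f : 𝔼 → ℝ} (hf : Tame b f) : Tame b (fun x => |f x|) :=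
  ⟨hf.meas.abs, by simpa using hf.bound⟩

lemma PolyBdd.abs {f : 𝔼 → ℝ} (hf : PolyBdd f) : PolyBdd (fun x => |f x|) :=
  ⟨hf.meas.abs, by simpa using hf.bound⟩

/-- The radial coefficient `x·∇φ / |x|²`. -/
def radialCoeff (φ : 𝔼 → ℝ) (x : 𝔼) : ℝ := (∑ i, x i * pd i φ x) / ‖x‖ ^ 2

lemma norm_rpow_add_one {p : ℝ} (hp : 1 < p) (z : ℂ) :
    ‖z‖ ^ (p + 1) = ‖z‖ ^ (p - 1) * inner ℝ z z := by
  rw [real_inner_self_eq_norm_sq, ← Real.rpow_natCast, ← Real.rpow_add_of_nonneg (norm_nonneg z)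
    (by linarith) (by norm_num)]
  congr 1; push_cast; ring

/-- The `i`-th partial derivative of `(|x|²+ε)^{-b/2} ψ |v|^{p+1}`. -/
def regDivTerm (b p ε : ℝ) (i : Fin N) (ψ : 𝔼 → ℝ) (v : 𝓢(𝔼, ℂ)) (x : 𝔼) : ℝ :=
  (‖x‖ ^ 2 + ε) ^ (-b / 2) * ((pd i ψ x * (‖v x‖ ^ (p - 1) * inner ℝ (v x) (v x)) -
    b * (‖x‖ ^ 2 + ε)⁻¹ * (x i * ψ x) * (‖v x‖ ^ (p - 1) * inner ℝ (v x) (v x))) +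
    (p + 1) * (ψ x * (‖v x‖ ^ (p - 1) * inner ℝ (v x) (dS i v x))))

lemma polyBdd_coord (i : Fin N) : PolyBdd (fun x : 𝔼 => x i) :=
  ⟨by fun_prop, 1, 1, zero_le_one, fun x => by
    have := PiLp.norm_apply_le x i
    rw [Real.norm_eq_abs] at this
    simp only [pow_one]; linarith⟩

lemma polyBdd_reg_rpow {b ε : ℝ} (hb : 0 < b) (hε : 0 < ε) :
    PolyBdd (fun x : 𝔼 => (‖x‖ ^ 2 + ε) ^ (-b / 2)) := by
  refine ⟨by fun_prop, ε ^ (-b / 2), 0, by positivity, fun x => ?_⟩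
  rw [abs_of_nonneg (by positivity), pow_zero, mul_one]
  exact Real.rpow_le_rpow_of_nonpos hε (by linarith [sq_nonneg ‖x‖]) (by linarith)

lemma polyBdd_reg_inv {ε : ℝ} (hε : 0 < ε) : PolyBdd (fun x : 𝔼 => (‖x‖ ^ 2 + ε)⁻¹) := by
  refine ⟨by fun_prop, ε⁻¹, 0, by positivity, fun x => ?_⟩
  rw [abs_of_nonneg (by positivity), pow_zero, mul_one]
  gcongr
  linarith [sq_nonneg ‖x‖]

lemma null_regDivTerm {b p ε : ℝ} (hb0 : 0 < b) (hb : b < N) (hp : 1 < p) (hε : 0 < ε) (i : Fin N)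
    {ψ : 𝔼 → ℝ} (hψ : Moderate 1 ψ) (v : 𝓢(𝔼, ℂ)) : Null b (regDivTerm b p ε i ψ v) := by
  have ht : Tame b (regDivTerm b p ε i ψ v) :=
    Tame.polyMul (polyBdd_reg_rpow hb0 hε) (((Tame.polyMul (hψ.pd (n := 0) i).polyBdd
      (tame_norm_rpow_mul b hp v v v)).sub
      (Tame.polyMul (((PolyBdd.const b).mul (polyBdd_reg_inv hε)).mul
        ((polyBdd_coord i).mul hψ.polyBdd)) (tame_norm_rpow_mul b hp v v v))).add
      ((Tame.polyMul hψ.polyBdd (tame_norm_rpow_mul b hp v v _)).constMul (p + 1)))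
  refine ⟨ht, ?_⟩
  have hd : ∀ x, HasFDerivAt (fun y => (‖y‖ ^ 2 + ε) ^ (-b / 2) * (ψ y * ‖v y‖ ^ (p + 1))) _ x :=
    fun x => ((((hasStrictFDerivAt_norm_sq x).hasFDerivAt.add_const ε).rpow_const
      (p := -b / 2) (Or.inl (by positivity))).mul
      ((Moderate.differentiable (n := 0) hψ x).hasFDerivAt.mul
      ((hasFDerivAt_norm_rpow (v x) (p := p + 1) (by linarith)).comp x (v.hasFDerivAt x))))
  have e : pd i (fun y => (‖y‖ ^ 2 + ε) ^ (-b / 2) * (ψ y * ‖v y‖ ^ (p + 1))) =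
      regDivTerm b p ε i ψ v := by
    ext x
    have hpos : 0 < ‖x‖ ^ 2 + ε := by positivity
    rw [pd, (hd x).fderiv]
    simp only [regDivTerm, pd, dS, SchwartzMap.lineDerivOp_apply_eq_fderiv,
      ← norm_rpow_add_one hp]
    have h1 : (‖x‖ ^ 2 + ε) ^ (-b / 2 - 1) = (‖x‖ ^ 2 + ε) ^ (-b / 2) * (‖x‖ ^ 2 + ε)⁻¹ := by
      rw [Real.rpow_sub_one hpos.ne', div_eq_mul_inv]
    have h2 : p + 1 - 2 = p - 1 := by ring
    simp [h1, h2, EuclideanSpace.inner_single_right]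
    ring
  rw [← e]
  refine integral_pd_eq_zero i (fun x => (hd x).differentiableAt) ?_ (e ▸ ht.integrable hb0 hb)
  simp_rw [norm_rpow_add_one hp]
  exact (Tame.polyMul (polyBdd_reg_rpow hb0 hε) (Tame.polyMul hψ.polyBdd
    (tame_norm_rpow_mul b hp v v v))).integrable hb0 hb

lemma Tame.congr {b : ℝ} {f g : 𝔼 → ℝ} (hf : Tame b f) (h : ∀ x, f x = g x) : Tame b g := by
  rwa [← (funext h : f = g)]

lemma sum_regDivTerm (b p ε : ℝ) (φ : 𝔼 → ℝ) (v : 𝓢(𝔼, ℂ)) (x : 𝔼) :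
    ∑ i, regDivTerm b p ε i (pd i φ) v x =
      (‖x‖ ^ 2 + ε) ^ (-b / 2) * ((lapR φ x * (‖v x‖ ^ (p - 1) * inner ℝ (v x) (v x)) -
        b * ((∑ i, x i * pd i φ x) * (‖x‖ ^ 2 + ε)⁻¹) *
          (‖v x‖ ^ (p - 1) * inner ℝ (v x) (v x))) +
        (p + 1) * ∑ i, pd i φ x * (‖v x‖ ^ (p - 1) * inner ℝ (v x) (dS i v x))) := by
  have h0 : lapR φ x = ∑ i, pd i (pd i φ) x := rfl
  simp only [regDivTerm]
  rw [h0, ← Finset.mul_sum, Finset.sum_add_distrib, Finset.sum_sub_distrib, ← Finset.mul_sum]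
  have e1 : ∑ i, b * (‖x‖ ^ 2 + ε)⁻¹ * (x i * pd i φ x) *
      (‖v x‖ ^ (p - 1) * inner ℝ (v x) (v x)) =
      b * ((∑ i, x i * pd i φ x) * (‖x‖ ^ 2 + ε)⁻¹) *
        (‖v x‖ ^ (p - 1) * inner ℝ (v x) (v x)) := by
    rw [Finset.sum_mul, Finset.mul_sum, Finset.sum_mul]
    exact Finset.sum_congr rfl fun i _ => by ring
  rw [e1, ← Finset.sum_mul]

lemma ae_ne_zero (hN : 1 ≤ N) : ∀ᵐ x : 𝔼, x ≠ 0 := by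
  have : NeZero N := ⟨by omega⟩
  have : Nontrivial 𝔼 := by
    have : Nonempty (Fin N) := ⟨0⟩
    infer_instance
  exact (measure_eq_zero_iff_ae_notMem.1 (measure_singleton (0 : 𝔼)))

lemma integral_weighted_divergence {b p : ℝ} (hN : 1 ≤ N) (hb0 : 0 < b) (hb : b < N) (hp : 1 < p)
    {φ : 𝔼 → ℝ} (hφ : Moderate 2 φ) (hκ : PolyBdd (radialCoeff φ)) (v : 𝓢(𝔼, ℂ)) :
    ∫ x, ‖x‖ ^ (-b) * ((lapR φ x * (‖v x‖ ^ (p - 1) * inner ℝ (v x) (v x)) -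
        b * radialCoeff φ x * (‖v x‖ ^ (p - 1) * inner ℝ (v x) (v x))) +
        (p + 1) * ∑ i, pd i φ x * (‖v x‖ ^ (p - 1) * inner ℝ (v x) (dS i v x))) = 0 := by
  have hn : ∀ ε : ℝ, 0 < ε → Null b (fun x => ∑ i, regDivTerm b p ε i (pd i φ) v x) :=
    fun ε hε => Null.sum hb0 hb _ fun i _ => null_regDivTerm hb0 hb hp hε i (hφ.pd i) v
  have hL := (Moderate.lapR (n := 0) hφ).polyBdd
  have hbd : Tame b (fun x => (|lapR φ x| *
        |‖x‖ ^ (-b) * (‖v x‖ ^ (p - 1) * inner ℝ (v x) (v x))| +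
      b * (|radialCoeff φ x| * |‖x‖ ^ (-b) * (‖v x‖ ^ (p - 1) * inner ℝ (v x) (v x))|)) +
      (p + 1) * ∑ i, |pd i φ x| *
        |‖x‖ ^ (-b) * (‖v x‖ ^ (p - 1) * inner ℝ (v x) (dS i v x))|) :=
    ((Tame.polyMul hL.abs (tame_rpow_mul hp v v v).abs).add
      ((Tame.polyMul hκ.abs (tame_rpow_mul hp v v v).abs).constMul b)).add
      ((Tame.sum _ fun i _ => Tame.polyMul (hφ.pd i).polyBdd.abs
        (tame_rpow_mul hp v v _).abs).constMul (p + 1))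
  have hlim : Tendsto (fun ε : ℝ => ∫ x, ∑ i, regDivTerm b p ε i (pd i φ) v x) (𝓝[>] 0)
      (𝓝 (∫ x, ‖x‖ ^ (-b) * ((lapR φ x * (‖v x‖ ^ (p - 1) * inner ℝ (v x) (v x)) -
        b * radialCoeff φ x * (‖v x‖ ^ (p - 1) * inner ℝ (v x) (v x))) +
        (p + 1) * ∑ i, pd i φ x * (‖v x‖ ^ (p - 1) * inner ℝ (v x) (dS i v x))))) := by
    refine tendsto_integral_filter_of_dominated_convergence _ ?_ ?_ (hbd.integrable hb0 hb) ?_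
    · filter_upwards [self_mem_nhdsWithin] with ε hε
      exact (hn ε hε).tame.meas.aestronglyMeasurable
    · filter_upwards [self_mem_nhdsWithin] with ε hε
      filter_upwards [ae_ne_zero hN] with x hx
      have hx' : 0 < ‖x‖ := norm_pos_iff.2 hx
      have hε' : (0 : ℝ) < ε := hε
      have hR : (‖x‖ ^ 2 + ε) ^ (-b / 2) ≤ ‖x‖ ^ (-b) := by
        calc (‖x‖ ^ 2 + ε) ^ (-b / 2) ≤ (‖x‖ ^ 2) ^ (-b / 2) :=
              Real.rpow_le_rpow_of_nonpos (by positivity) (by linarith) (by linarith)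
          _ = ‖x‖ ^ (-b) := by
              rw [← Real.rpow_natCast, ← Real.rpow_mul hx'.le]; congr 1; push_cast; ring
      have hS : |(∑ i, x i * pd i φ x) * (‖x‖ ^ 2 + ε)⁻¹| ≤ |radialCoeff φ x| := by
        rw [radialCoeff, abs_mul, abs_div, abs_inv, ← div_eq_mul_inv]
        gcongr
        linarith
      have hG : 0 ≤ ‖v x‖ ^ (p - 1) * inner ℝ (v x) (v x) :=
        mul_nonneg (by positivity) real_inner_self_nonneg
      set G := ‖v x‖ ^ (p - 1) * inner ℝ (v x) (v x)
      set S := (∑ i, x i * pd i φ x) * (‖x‖ ^ 2 + ε)⁻¹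
      rw [sum_regDivTerm, Real.norm_eq_abs, abs_mul, abs_of_nonneg (by positivity)]
      have h3 : 0 ≤ ‖x‖ ^ (-b) := by positivity
      calc (‖x‖ ^ 2 + ε) ^ (-b / 2) * |lapR φ x * G - b * S * G +
            (p + 1) * ∑ i, pd i φ x * (‖v x‖ ^ (p - 1) * inner ℝ (v x) (dS i v x))|
          ≤ ‖x‖ ^ (-b) * ((|lapR φ x| * |G| + b * |radialCoeff φ x| * |G|) +
            (p + 1) * ∑ i, |pd i φ x| * |‖v x‖ ^ (p - 1) * inner ℝ (v x) (dS i v x)|) := by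
            refine mul_le_mul hR ?_ (abs_nonneg _) h3
            refine (abs_add_le _ _).trans (add_le_add ((abs_sub _ _).trans
              (add_le_add (abs_mul _ _).le ?_)) ?_)
            · rw [abs_mul, abs_mul, abs_of_pos hb0]
              gcongr
            · rw [abs_mul, abs_of_pos (by linarith : 0 < p + 1)]
              refine mul_le_mul_of_nonneg_left ?_ (by linarith)
              refine (Finset.abs_sum_le_sum_abs _ _).trans (Finset.sum_le_sum fun i _ => ?_)
              rw [abs_mul]
        _ = _ := by
            rw [mul_add, mul_add]
            congr 1
            · rw [abs_mul (‖x‖ ^ (-b)), abs_of_nonneg h3]; ring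
            · rw [mul_left_comm, Finset.mul_sum]
              congr 1
              refine Finset.sum_congr rfl fun i _ => ?_
              rw [abs_mul (‖x‖ ^ (-b)), abs_of_nonneg h3]; ring
    · filter_upwards [ae_ne_zero hN] with x hx
      have hx' : 0 < ‖x‖ := norm_pos_iff.2 hx
      simp_rw [sum_regDivTerm]
      have e1 : ‖x‖ ^ (-b) = (‖x‖ ^ 2 + 0) ^ (-b / 2) := by
        rw [add_zero, ← Real.rpow_natCast, ← Real.rpow_mul hx'.le]; congr 1; push_cast; ring
      have e2 : radialCoeff φ x = (∑ i, x i * pd i φ x) * (‖x‖ ^ 2 + 0)⁻¹ := by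
        rw [add_zero, radialCoeff, div_eq_mul_inv]
      rw [e1, e2]
      have hne : ‖x‖ ^ 2 + (0 : ℝ) ≠ 0 := by positivity
      have c1 : Tendsto (fun ε : ℝ => ‖x‖ ^ 2 + ε) (𝓝[>] 0) (𝓝 (‖x‖ ^ 2 + 0)) :=
        (tendsto_const_nhds.add tendsto_id).mono_left nhdsWithin_le_nhds
      have c2 := c1.rpow_const (p := -b / 2) (Or.inl hne)
      have c3 := c1.inv₀ hne
      exact c2.mul ((tendsto_const_nhds.sub
        ((tendsto_const_nhds.mul (tendsto_const_nhds.mul c3)).mul tendsto_const_nhds)).add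
        tendsto_const_nhds)
  have hzero : Tendsto (fun ε : ℝ => ∫ x, ∑ i, regDivTerm b p ε i (pd i φ) v x) (𝓝[>] 0)
      (𝓝 0) := by
    refine tendsto_const_nhds.congr' ?_
    filter_upwards [self_mem_nhdsWithin] with ε hε
    exact (hn ε hε).integral.symm
  exact tendsto_nhds_unique hlim hzero

/-- The nonlinearity `|x|^{-b}|v|^{p-1}v`. -/
def nonlin (b p : ℝ) (v : 𝓢(𝔼, ℂ)) (x : 𝔼) : ℂ :=
  ((‖x‖ ^ (-b) * ‖v x‖ ^ (p - 1) : ℝ) : ℂ) * v x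

lemma inner_nonlin (b p : ℝ) (v : 𝓢(𝔼, ℂ)) (x : 𝔼) (z : ℂ) :
    inner ℝ (nonlin b p v x) z = ‖x‖ ^ (-b) * (‖v x‖ ^ (p - 1) * inner ℝ (v x) z) := by
  rw [nonlin]
  simp only [inner_complex, Complex.re_ofReal_mul, Complex.im_ofReal_mul]; ring

lemma tame_inner_nonlin_virialOp {b p : ℝ} (hp : 1 < p) {φ : 𝔼 → ℝ} (hφ : Moderate 2 φ)
    (v : 𝓢(𝔼, ℂ)) : Tame b (fun x => inner ℝ (nonlin b p v x) (virialOp φ v x)) := by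
  simp_rw [inner_virialOp, inner_nonlin, div_eq_mul_inv]
  exact (Tame.sum _ fun i _ => Tame.polyMul (hφ.pd i).polyBdd (tame_rpow_mul hp v v _)).add
    (Tame.polyMul ((Moderate.lapR (n := 0) hφ).polyBdd.mul (PolyBdd.const 2⁻¹))
      (tame_rpow_mul hp v v v))

lemma integral_inner_nonlin_virialOp {b p : ℝ} (hN : 1 ≤ N) (hb0 : 0 < b) (hb : b < N)
    (hp : 1 < p) {φ : 𝔼 → ℝ} (hφ : Moderate 2 φ) (hκ : PolyBdd (radialCoeff φ))
    (v : 𝓢(𝔼, ℂ)) :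
    ∫ x, (-4) * inner ℝ (nonlin b p v x) (virialOp φ v x) =
      ∫ x, -(2 * (p - 1) / (p + 1)) * ((lapR φ x + 2 * b / (p - 1) * radialCoeff φ x) *
        (‖x‖ ^ (-b) * ‖v x‖ ^ (p + 1))) := by
  have hL := (Moderate.lapR (n := 0) hφ).polyBdd
  have hp1 : p - 1 ≠ 0 := by linarith
  have hp2 : p + 1 ≠ 0 := by linarith
  simp_rw [norm_rpow_add_one hp]
  have ht : Tame b (fun x => ‖x‖ ^ (-b) *
      ((lapR φ x * (‖v x‖ ^ (p - 1) * inner ℝ (v x) (v x)) -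
        b * radialCoeff φ x * (‖v x‖ ^ (p - 1) * inner ℝ (v x) (v x))) +
        (p + 1) * ∑ i, pd i φ x * (‖v x‖ ^ (p - 1) * inner ℝ (v x) (dS i v x)))) := by
    have := ((Tame.polyMul hL (tame_rpow_mul (b := b) hp v v v)).sub
      ((Tame.polyMul hκ (tame_rpow_mul (b := b) hp v v v)).constMul b)).add
      ((Tame.sum Finset.univ fun i _ => Tame.polyMul (hφ.pd i).polyBdd
        (tame_rpow_mul (b := b) hp v v (dS i v))).constMul (p + 1))
    convert this using 2 with x
    rw [mul_add, mul_left_comm _ (p + 1), Finset.mul_sum]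
    congr 1
    · ring
    · congr 1
      refine Finset.sum_congr rfl fun i _ => ?_
      ring
  refine (Null.constMul (-4 / (p + 1)) ⟨ht, integral_weighted_divergence hN hb0 hb hp hφ hκ
    v⟩).integral_eq hb0 hb ((tame_inner_nonlin_virialOp hp hφ v).constMul _)
    ((Tame.polyMul (hL.add (hκ.mul (PolyBdd.const (2 * b / (p - 1)))))
      (tame_rpow_mul hp v v v)).constMul (-(2 * (p - 1) / (p + 1))) |>.congr ?_) fun x => ?_
  · intro x; ring
  · rw [inner_virialOp, inner_nonlin]
    simp_rw [inner_nonlin]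
    have : ∑ i, pd i φ x * (‖x‖ ^ (-b) * (‖v x‖ ^ (p - 1) * inner ℝ (v x) (dS i v x))) =
        ‖x‖ ^ (-b) * ∑ i, pd i φ x * (‖v x‖ ^ (p - 1) * inner ℝ (v x) (dS i v x)) := by
      rw [Finset.mul_sum]; exact Finset.sum_congr rfl fun i _ => by ring
    rw [this]
    generalize ∑ i, pd i φ x * (‖v x‖ ^ (p - 1) * inner ℝ (v x) (dS i v x)) = S
    field_simp
    ring

lemma fderiv_zero_of_even {f : 𝔼 → ℝ} (hf : DifferentiableAt ℝ f 0) (h : ∀ x, f (-x) = f x) :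
    fderiv ℝ f 0 = 0 := by
  have h1 : HasFDerivAt f (fderiv ℝ f 0) (-(0 : 𝔼)) := by simpa using hf.hasFDerivAt
  have h2 := h1.comp (0 : 𝔼) (hasFDerivAt_id (𝕜 := ℝ) (0 : 𝔼)).neg
  have h3 : f ∘ Neg.neg = f := funext h
  rw [h3] at h2
  have h4 := h2.unique hf.hasFDerivAt
  ext y
  have h5 := congrArg (fun L : 𝔼 →L[ℝ] ℝ => L y) h4
  simp only [ContinuousLinearMap.comp_apply, _root_.neg_apply, ContinuousLinearMap.id_apply,
    map_neg] at h5
  simp only [_root_.zero_apply]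
  linarith

lemma sum_coord_mul_pd (f : 𝔼 → ℝ) (x : 𝔼) : ∑ i, x i * pd i f x = fderiv ℝ f x x := by
  have h : x = ∑ i, x i • EuclideanSpace.single i (1 : ℝ) := by
    simpa using ((EuclideanSpace.basisFun (Fin N) ℝ).sum_repr x).symm
  conv_rhs => rw [h]
  simp only [map_sum, map_smul, smul_eq_mul, pd]
  rw [← h]

lemma polyBdd_radialCoeff {f : 𝔼 → ℝ} (hf : Moderate 2 f) (h0 : fderiv ℝ f 0 = 0) :
    PolyBdd (radialCoeff f) := by
  have hm : Measurable (radialCoeff f) :=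
    (PolyBdd.sum Finset.univ fun i _ => (polyBdd_coord i).mul (hf.pd i).polyBdd).meas.div
      (by fun_prop)
  obtain ⟨h, C, m, hC⟩ := hf
  have hd : Differentiable ℝ (fderiv ℝ f) :=
    (h.fderiv_right (m := 1) (by norm_num)).differentiable (by norm_num)
  refine ⟨hm, |C|, m, abs_nonneg C, fun x => ?_⟩
  have h1 : ‖fderiv ℝ f x‖ ≤ |C| * (1 + ‖x‖) ^ m * ‖x‖ := by
    have := (convex_closedBall (0 : 𝔼) ‖x‖).norm_image_sub_le_of_norm_fderiv_le (𝕜 := ℝ)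
      (f := fderiv ℝ f) (C := |C| * (1 + ‖x‖) ^ m) (x := 0) (y := x) (fun y _ => hd y)
      (fun y hy => ?_) (by simp) (by simp)
    · simpa [h0] using this
    · have hy' : ‖y‖ ≤ ‖x‖ := by simpa using hy
      rw [← norm_iteratedFDeriv_one, norm_iteratedFDeriv_fderiv]
      exact (hC y 2 le_rfl).trans (by gcongr; exact le_abs_self C)
  rcases eq_or_ne x 0 with rfl | hx
  · simp [radialCoeff]
  have hx' : 0 < ‖x‖ := norm_pos_iff.2 hx
  rw [radialCoeff, sum_coord_mul_pd, abs_div, abs_of_pos (by positivity : 0 < ‖x‖ ^ 2),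
    div_le_iff₀ (by positivity)]
  calc |fderiv ℝ f x x| ≤ ‖fderiv ℝ f x‖ * ‖x‖ := (fderiv ℝ f x).le_opNorm x
    _ ≤ |C| * (1 + ‖x‖) ^ m * ‖x‖ * ‖x‖ := by gcongr
    _ = _ := by ring

lemma contDiffAt_of_radial {n : ℕ∞ω} {w : ℝ → ℝ} (h : ContDiff ℝ n fun x : 𝔼 => w ‖x‖) {x : 𝔼}
    (hx : x ≠ 0) : ContDiffAt ℝ n w ‖x‖ := by
  have hx' : 0 < ‖x‖ := norm_pos_iff.2 hx
  have h1 : ContDiff ℝ n fun s : ℝ => w ‖(s * ‖x‖⁻¹) • x‖ :=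
    h.comp ((contDiff_id.mul contDiff_const).smul contDiff_const)
  refine h1.contDiffAt.congr_of_eventuallyEq ?_
  filter_upwards [lt_mem_nhds hx'] with s hs
  congr 1
  rw [norm_smul, Real.norm_eq_abs, abs_of_pos (by positivity)]
  field_simp

lemma inner_single_one (x : 𝔼) (i : Fin N) : inner ℝ x (EuclideanSpace.single i 1) = x i := by
  rw [EuclideanSpace.inner_single_right]; simp

lemma hasFDerivAt_norm {x : 𝔼} (hx : x ≠ 0) :
    HasFDerivAt (fun y : 𝔼 => ‖y‖) (‖x‖⁻¹ • innerSL ℝ x) x := by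
  have hx' : 0 < ‖x‖ := norm_pos_iff.2 hx
  have h := (hasStrictFDerivAt_norm_sq x).hasFDerivAt.sqrt (by positivity)
  simp only [Real.sqrt_sq (norm_nonneg _)] at h
  convert! h using 1
  ext y
  simp
  field_simp

lemma pd_radial {w : ℝ → ℝ} {x : 𝔼} (hx : x ≠ 0) (hw : DifferentiableAt ℝ w ‖x‖) (i : Fin N) :
    pd i (fun y : 𝔼 => w ‖y‖) x = deriv w ‖x‖ * (‖x‖⁻¹ * x i) := by
  have h : HasFDerivAt (fun y : 𝔼 => w ‖y‖) _ x :=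
    hw.hasDerivAt.comp_hasFDerivAt x (hasFDerivAt_norm hx)
  rw [pd, h.fderiv]
  simp [inner_single_one]

lemma pd_pd_radial {w : ℝ → ℝ} (h : ContDiff ℝ 4 fun x : 𝔼 => w ‖x‖) {x : 𝔼} (hx : x ≠ 0)
    (j k : Fin N) : pd j (pd k fun y : 𝔼 => w ‖y‖) x =
      (deriv (deriv w) ‖x‖ / ‖x‖ ^ 2 - deriv w ‖x‖ / ‖x‖ ^ 3) * (x j * x k) +
        deriv w ‖x‖ / ‖x‖ * (if j = k then 1 else 0) := by
  have hx' : 0 < ‖x‖ := norm_pos_iff.2 hx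
  have hw : DifferentiableAt ℝ (deriv w) ‖x‖ :=
    (((contDiffAt_of_radial h hx).fderiv_right (m := 1) (by norm_num)).clm_apply
      (contDiffAt_const (c := (1 : ℝ)))).differentiableAt (by norm_num)
  have he : pd k (fun y : 𝔼 => w ‖y‖) =ᶠ[𝓝 x] fun y => deriv w ‖y‖ * (‖y‖⁻¹ * y k) := by
    filter_upwards [isOpen_ne.mem_nhds hx] with y hy
    exact pd_radial hy ((contDiffAt_of_radial h hy).differentiableAt (by norm_num)) k
  have hk : HasFDerivAt (fun y : 𝔼 => y k) (EuclideanSpace.proj k : 𝔼 →L[ℝ] ℝ) x :=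
    (EuclideanSpace.proj k : 𝔼 →L[ℝ] ℝ).hasFDerivAt
  have hn := hasFDerivAt_norm hx
  have hd : HasFDerivAt (fun y : 𝔼 => deriv w ‖y‖ * (‖y‖⁻¹ * y k)) _ x := (hw.hasDerivAt.comp_hasFDerivAt x hn).mul
    (((hasDerivAt_inv hx'.ne').comp_hasFDerivAt x hn).mul hk)
  rw [pd, he.fderiv_eq, hd.fderiv]
  simp [inner_single_one]
  split_ifs with h1 h2 h2
  · field_simp; ring
  · exact absurd h1.symm h2
  · exact absurd h2.symm h1
  · field_simp; ring

lemma norm_sq_eq_sum (x : 𝔼) : ‖x‖ ^ 2 = ∑ i, x i * x i := by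
  rw [EuclideanSpace.norm_sq_eq]
  exact Finset.sum_congr rfl fun i _ => by rw [Real.norm_eq_abs, sq_abs, sq]

lemma radialCoeff_radial {w : ℝ → ℝ} (h : ContDiff ℝ 4 fun x : 𝔼 => w ‖x‖) {x : 𝔼} (hx : x ≠ 0) :
    radialCoeff (fun y : 𝔼 => w ‖y‖) x = deriv w ‖x‖ / ‖x‖ := by
  have hx' : 0 < ‖x‖ := norm_pos_iff.2 hx
  have hw := (contDiffAt_of_radial h hx).differentiableAt (by norm_num)
  have e : ∑ i, x i * pd i (fun y : 𝔼 => w ‖y‖) x = deriv w ‖x‖ * ‖x‖⁻¹ * ‖x‖ ^ 2 := by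
    rw [norm_sq_eq_sum, Finset.mul_sum]
    exact Finset.sum_congr rfl fun i _ => by rw [pd_radial hx hw]; ring
  rw [radialCoeff, e]
  field_simp

lemma lapR_radial {w : ℝ → ℝ} (h : ContDiff ℝ 4 fun x : 𝔼 => w ‖x‖) {x : 𝔼} (hx : x ≠ 0) :
    lapR (fun y : 𝔼 => w ‖y‖) x =
      deriv (deriv w) ‖x‖ + ((N : ℝ) - 1) * (deriv w ‖x‖ / ‖x‖) := by
  have hx' : 0 < ‖x‖ := norm_pos_iff.2 hx
  have e : lapR (fun y : 𝔼 => w ‖y‖) x = ∑ i, pd i (pd i fun y : 𝔼 => w ‖y‖) x := rfl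
  simp_rw [e, pd_pd_radial h hx]
  rw [Finset.sum_add_distrib, ← Finset.mul_sum, ← norm_sq_eq_sum]
  simp
  field_simp
  ring

lemma hessian_radial {w : ℝ → ℝ} (h : ContDiff ℝ 4 fun x : 𝔼 => w ‖x‖) {x : 𝔼} (hx : x ≠ 0)
    (z : Fin N → ℂ) :
    ∑ j, ∑ k, pd j (pd k fun y : 𝔼 => w ‖y‖) x * inner ℝ (z j) (z k) =
      (deriv w ‖x‖ / ‖x‖) * ∑ i, ‖z i‖ ^ 2 +
        (deriv (deriv w) ‖x‖ / ‖x‖ ^ 2 - deriv w ‖x‖ / ‖x‖ ^ 3) *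
          ‖∑ i, (x i : ℂ) * z i‖ ^ 2 := by
  have e1 : ‖∑ i, (x i : ℂ) * z i‖ ^ 2 = ∑ j, ∑ k, x j * x k * inner ℝ (z j) (z k) := by
    rw [← real_inner_self_eq_norm_sq, sum_inner]
    refine Finset.sum_congr rfl fun j _ => ?_
    rw [inner_sum]
    refine Finset.sum_congr rfl fun k _ => ?_
    simp only [inner_complex, Complex.re_ofReal_mul, Complex.im_ofReal_mul]; ring
  rw [e1, Finset.mul_sum, Finset.mul_sum, ← Finset.sum_add_distrib]
  refine Finset.sum_congr rfl fun j _ => ?_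
  simp_rw [pd_pd_radial h hx, add_mul]
  rw [Finset.sum_add_distrib, Finset.mul_sum, add_comm]
  congr 1
  · simp only [mul_ite, mul_one, mul_zero, ite_mul, zero_mul, Finset.sum_ite_eq, Finset.mem_univ,
      if_true, real_inner_self_eq_norm_sq]
  · exact Finset.sum_congr rfl fun k _ => by ring

/-- The time derivative `i(Δv + |x|^{-b}|v|^{p-1}v)` prescribed by the equation. -/
def timeDeriv (b p : ℝ) (v : 𝓢(𝔼, ℂ)) (x : 𝔼) : ℂ :=
  Complex.I * (lap v x + nonlin b p v x)

lemma INLSSolution.hasDerivWithinAt {b p : ℝ} {J : Set ℝ} (sol : INLSSolution N b p J) {t : ℝ}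
    (ht : t ∈ J) {x : 𝔼} (hx : x ≠ 0) :
    HasDerivWithinAt (fun s => sol.u s x) (timeDeriv b p (sol.u t) x) J t := by
  obtain ⟨z, hz, h⟩ := sol.eqn t ht x hx
  have : timeDeriv b p (sol.u t) x = z := by
    rw [timeDeriv, nonlin]
    linear_combination Complex.I * h - z * Complex.I_sq
  rwa [this]

lemma exists_timeDeriv_bound (b : ℝ) {p : ℝ} (hp : 1 < p) {𝒱 : Set 𝓢(𝔼, ℂ)}
    (h : ∀ k n : ℕ, ∃ C : ℝ, ∀ v ∈ 𝒱, SchwartzMap.seminorm ℝ k n v ≤ C) (k : ℕ) :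
    ∃ C : ℝ, 0 ≤ C ∧ ∀ v ∈ 𝒱, ∀ x,
      ‖timeDeriv b p v x‖ * (1 + ‖x‖) ^ k ≤ C * (1 + ‖x‖ ^ (-b)) := by
  obtain ⟨A, hA, h2⟩ := weighted_bound_of_seminorm h k 2
  obtain ⟨B, hB, h0⟩ := weighted_bound_of_seminorm h k 0
  obtain ⟨M, hM, h1⟩ := weighted_bound_of_seminorm h 0 0
  refine ⟨N * A + M ^ (p - 1) * B, by positivity, fun v hv x => ?_⟩
  have e1 : ‖lap v x‖ * (1 + ‖x‖) ^ k ≤ N * A := by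
    have : ‖lap v x‖ ≤ ∑ _i : Fin N, ‖iteratedFDeriv ℝ 2 v x‖ := by
      rw [lap_schwartz]
      refine (norm_sum_le _ _).trans (Finset.sum_le_sum fun i _ => ?_)
      have a1 := norm_dS_le i (dS i v) 0 x
      rw [norm_iteratedFDeriv_zero] at a1
      exact a1.trans (norm_dS_le i v 1 x)
    rw [Finset.sum_const, Finset.card_univ, Fintype.card_fin, nsmul_eq_mul] at this
    calc ‖lap v x‖ * (1 + ‖x‖) ^ k ≤ N * ‖iteratedFDeriv ℝ 2 v x‖ * (1 + ‖x‖) ^ k := by gcongr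
      _ = N * (‖iteratedFDeriv ℝ 2 v x‖ * (1 + ‖x‖) ^ k) := by ring
      _ ≤ N * A := by gcongr; exact h2 v hv x
  have hr : 0 ≤ ‖x‖ ^ (-b) := by positivity
  have e2 : ‖nonlin b p v x‖ * (1 + ‖x‖) ^ k ≤ M ^ (p - 1) * B * ‖x‖ ^ (-b) := by
    have a1 : ‖v x‖ ≤ M := by simpa using h1 v hv x
    have a0 : ‖v x‖ * (1 + ‖x‖) ^ k ≤ B := by simpa using h0 v hv x
    have a2 : ‖v x‖ ^ (p - 1) ≤ M ^ (p - 1) :=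
      Real.rpow_le_rpow (norm_nonneg _) a1 (by linarith)
    rw [nonlin, norm_mul, Complex.norm_real, Real.norm_eq_abs, abs_of_nonneg (by positivity)]
    calc ‖x‖ ^ (-b) * ‖v x‖ ^ (p - 1) * ‖v x‖ * (1 + ‖x‖) ^ k
        = ‖x‖ ^ (-b) * (‖v x‖ ^ (p - 1) * (‖v x‖ * (1 + ‖x‖) ^ k)) := by ring
      _ ≤ ‖x‖ ^ (-b) * (M ^ (p - 1) * B) := by gcongr
      _ = _ := by ring
  calc ‖timeDeriv b p v x‖ * (1 + ‖x‖) ^ k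
      ≤ (‖lap v x‖ + ‖nonlin b p v x‖) * (1 + ‖x‖) ^ k := by
        rw [timeDeriv, norm_mul, Complex.norm_I, one_mul]
        gcongr
        exact norm_add_le _ _
    _ ≤ N * A + M ^ (p - 1) * B * ‖x‖ ^ (-b) := by rw [add_mul]; exact add_le_add e1 e2
    _ ≤ _ := by
        have p1 : 0 ≤ N * A * ‖x‖ ^ (-b) := by positivity
        have p2 : 0 ≤ M ^ (p - 1) * B := by positivity
        linarith

lemma INLSSolution.seminorm_image_bound {b p : ℝ} {J : Set ℝ} (sol : INLSSolution N b p J)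
    {a c : ℝ} (hK : Icc a c ⊆ J) (k n : ℕ) :
    ∃ C : ℝ, ∀ v ∈ sol.u '' Icc a c, SchwartzMap.seminorm ℝ k n v ≤ C := by
  obtain ⟨C, hC⟩ := sol.seminorm_bound _ hK isCompact_Icc k n
  exact ⟨C, by rintro _ ⟨s, hs, rfl⟩; exact hC s hs⟩

lemma INLSSolution.exists_lipschitz_bound {b p : ℝ} (hp : 1 < p) {J : Set ℝ}
    (sol : INLSSolution N b p J) {a c : ℝ} (hK : Icc a c ⊆ J) (k : ℕ) :
    ∃ C : ℝ, 0 ≤ C ∧ ∀ s ∈ Icc a c, ∀ t ∈ Icc a c, ∀ x ≠ 0,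
      ‖sol.u s x - sol.u t x‖ * (1 + ‖x‖) ^ k ≤ C * (1 + ‖x‖ ^ (-b)) * |s - t| := by
  obtain ⟨C, hC, h⟩ := exists_timeDeriv_bound b hp (sol.seminorm_image_bound hK) k
  refine ⟨C, hC, fun s hs t ht x hx => ?_⟩
  have hpos : 0 < (1 + ‖x‖) ^ k := by positivity
  have := (convex_Icc a c).norm_image_sub_le_of_norm_hasDerivWithin_le
    (f := fun s => sol.u s x) (f' := fun s => timeDeriv b p (sol.u s) x)
    (C := C * (1 + ‖x‖ ^ (-b)) / (1 + ‖x‖) ^ k)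
    (fun r hr => (sol.hasDerivWithinAt (hK hr) hx).mono hK)
    (fun r hr => (le_div_iff₀ hpos).2 (h _ (mem_image_of_mem _ hr) x)) ht hs
  rw [Real.norm_eq_abs, div_mul_eq_mul_div, le_div_iff₀ hpos] at this
  exact this

lemma exists_Icc_mem_nhdsWithin {J : Set ℝ} (hJ : J.OrdConnected) {t : ℝ} (ht : t ∈ J) :
    ∃ a c, t ∈ Icc a c ∧ Icc a c ⊆ J ∧ Icc a c ∈ 𝓝[J] t := by
  obtain ⟨a, haJ, hat, ha⟩ : ∃ a ∈ J, a ≤ t ∧ ∀ᶠ s in 𝓝[J] t, a ≤ s := by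
    by_cases h : ∃ a ∈ J, a < t
    · obtain ⟨a, haJ, hat⟩ := h
      exact ⟨a, haJ, hat.le, (le_mem_nhds hat).filter_mono nhdsWithin_le_nhds⟩
    · push Not at h
      exact ⟨t, ht, le_rfl, eventually_mem_nhdsWithin.mono fun s hs => h s hs⟩
  obtain ⟨c, hcJ, htc, hc⟩ : ∃ c ∈ J, t ≤ c ∧ ∀ᶠ s in 𝓝[J] t, s ≤ c := by
    by_cases h : ∃ c ∈ J, t < c
    · obtain ⟨c, hcJ, htc⟩ := h
      exact ⟨c, hcJ, htc.le, (ge_mem_nhds htc).filter_mono nhdsWithin_le_nhds⟩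
    · push Not at h
      exact ⟨t, ht, le_rfl, eventually_mem_nhdsWithin.mono fun s hs => h s hs⟩
  exact ⟨a, c, ⟨hat, htc⟩, hJ.out haJ hcJ, ha.and hc⟩

lemma INLSSolution.continuousOn_dS {b p : ℝ} {J : Set ℝ} (hJ : J.OrdConnected)
    (sol : INLSSolution N b p J) (i : Fin N) {x : 𝔼} (hx : x ≠ 0) :
    ContinuousOn (fun s => dS i (sol.u s) x) J := by
  rcases J.subsingleton_or_nontrivial with h | h
  · exact h.continuousOn _
  have hO : IsOpen {x : 𝔼 | x ≠ 0} := isOpen_ne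
  have hU : UniqueDiffOn ℝ (J ×ˢ {x : 𝔼 | x ≠ 0}) :=
    (uniqueDiffOn_convex hJ.convex (hJ.convex.nontrivial_iff_nonempty_interior.1 h)).prod
      hO.uniqueDiffOn
  have hc := sol.smooth.continuousOn_fderivWithin hU (by simp)
  have hc' : ContinuousOn (fun s => fderivWithin ℝ
      (fun q : ℝ × 𝔼 => sol.u q.1 q.2) (J ×ˢ {x : 𝔼 | x ≠ 0}) (s, x)
        (0, EuclideanSpace.single i 1)) J :=
    (hc.comp (by fun_prop : ContinuousOn (fun s : ℝ => (s, x)) J)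
      fun s hs => ⟨hs, hx⟩).clm_apply continuousOn_const
  refine hc'.congr fun s hs => ?_
  have h1 := (sol.smooth.differentiableOn (by simp) (s, x) ⟨hs, hx⟩).hasFDerivWithinAt
  have h2 : HasFDerivAt (fun y : 𝔼 => (s, y)) (ContinuousLinearMap.inr ℝ ℝ 𝔼) x :=
    hasFDerivAt_prodMk_right s x
  have h3 := h1.comp x h2.hasFDerivWithinAt (s := {x : 𝔼 | x ≠ 0}) fun y hy => ⟨hs, hy⟩
  have h4 := h3.hasFDerivAt (hO.mem_nhds hx)
  have h5 : dS i (sol.u s) x = fderiv ℝ (sol.u s : 𝔼 → ℂ) x (EuclideanSpace.single i 1) := rfl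
  have h6 : fderiv ℝ (sol.u s : 𝔼 → ℂ) x = _ := h4.fderiv
  rw [h5, h6]
  simp

/-- Differentiation in time of a symmetric quadratic form of order at most one along a solution. -/
lemma INLSSolution.hasDerivWithinAt_integral {b p : ℝ} (hN : 1 ≤ N) (hb0 : 0 < b) (hb : b < N)
    (hp : 1 < p) {J : Set ℝ} (hJ : J.OrdConnected) (sol : INLSSolution N b p J)
    {T : 𝓢(𝔼, ℂ) → 𝔼 → ℂ} (hT : ∀ v w : 𝓢(𝔼, ℂ), Integrable fun x => inner ℝ (v x) (T w x))
    (hsymm : ∀ v w : 𝓢(𝔼, ℂ), ∫ x, inner ℝ (v x) (T w x) = ∫ x, inner ℝ (w x) (T v x))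
    (hbound : ∃ (C : ℝ) (m : ℕ), 0 ≤ C ∧
      ∀ v x, ‖T v x‖ ≤ C * (1 + ‖x‖) ^ m * (‖v x‖ + ∑ i, ‖dS i v x‖))
    (hcont : ∀ x ≠ 0, ContinuousOn (fun s => T (sol.u s) x) J) {t : ℝ} (ht : t ∈ J) :
    HasDerivWithinAt (fun s => ∫ x, inner ℝ (sol.u s x) (T (sol.u s) x))
      (∫ x, 2 * inner ℝ (timeDeriv b p (sol.u t) x) (T (sol.u t) x)) J t := by
  obtain ⟨a, c, htK, hK, hKn⟩ := exists_Icc_mem_nhdsWithin hJ ht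
  obtain ⟨D, m, hD, hTb⟩ := hbound
  obtain ⟨A, hA, h0⟩ := weighted_bound_of_seminorm (sol.seminorm_image_bound hK) 0 0
  obtain ⟨B, hB, h1⟩ := weighted_bound_of_seminorm (sol.seminorm_image_bound hK) 0 1
  obtain ⟨L, hL, hlip⟩ := sol.exists_lipschitz_bound hp hK (m + (N + 1))
  have hTK : ∀ s ∈ Icc a c, ∀ x, ‖T (sol.u s) x‖ ≤ D * (A + N * B) * (1 + ‖x‖) ^ m := by
    intro s hs x
    have a0 : ‖sol.u s x‖ ≤ A := by simpa using h0 _ (mem_image_of_mem _ hs) x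
    have a1 : ∑ i, ‖dS i (sol.u s) x‖ ≤ N * B := by
      have : ∑ i, ‖dS i (sol.u s) x‖ ≤ ∑ _i : Fin N, B := by
        refine Finset.sum_le_sum fun i _ => ?_
        have a2 := norm_dS_le i (sol.u s) 0 x
        rw [norm_iteratedFDeriv_zero] at a2
        exact a2.trans (by simpa using h1 _ (mem_image_of_mem _ hs) x)
      simpa using this
    calc ‖T (sol.u s) x‖ ≤ D * (1 + ‖x‖) ^ m * (‖sol.u s x‖ + ∑ i, ‖dS i (sol.u s) x‖) := hTb _ x
      _ ≤ D * (1 + ‖x‖) ^ m * (A + N * B) := by gcongr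
      _ = _ := by ring
  have hsum : ∀ v w z : 𝓢(𝔼, ℂ),
      Integrable fun x => inner ℝ (v x) (T w x) + inner ℝ (v x) (T z x) :=
    fun v w z => (hT v w).add (hT v z)
  have hint : ∀ s, (∫ x, inner ℝ (sol.u s x) (T (sol.u s) x)) -
        ∫ x, inner ℝ (sol.u t x) (T (sol.u t) x) =
      ∫ x, inner ℝ (sol.u s x - sol.u t x) (T (sol.u s) x + T (sol.u t) x) := by
    intro s
    have e : ∀ x, inner ℝ (sol.u s x - sol.u t x) (T (sol.u s) x + T (sol.u t) x) =
        (inner ℝ (sol.u s x) (T (sol.u s) x) + inner ℝ (sol.u s x) (T (sol.u t) x)) -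
        (inner ℝ (sol.u t x) (T (sol.u s) x) + inner ℝ (sol.u t x) (T (sol.u t) x)) := by
      intro x; rw [inner_sub_left, inner_add_right, inner_add_right]
    simp_rw [e]
    rw [integral_sub (hsum _ _ _) (hsum _ _ _),
      integral_add (hT _ _) (hT _ _), integral_add (hT _ _) (hT _ _), hsymm (sol.u s) (sol.u t)]
    ring
  rw [hasDerivWithinAt_iff_tendsto_slope]
  have hslope : slope (fun s => ∫ x, inner ℝ (sol.u s x) (T (sol.u s) x)) t = fun s =>
      ∫ x, (s - t)⁻¹ * inner ℝ (sol.u s x - sol.u t x) (T (sol.u s) x + T (sol.u t) x) := by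
    ext s
    rw [slope_def_module, hint, integral_const_mul, smul_eq_mul]
  rw [hslope]
  have hKn' : ∀ᶠ s in 𝓝[J \ {t}] t, s ∈ Icc a c ∧ s ≠ t :=
    ((show ∀ᶠ s in 𝓝[J] t, s ∈ Icc a c from hKn).filter_mono
      (nhdsWithin_mono _ sdiff_subset)).and
      (eventually_mem_nhdsWithin.mono fun s hs => hs.2)
  refine tendsto_integral_filter_of_dominated_convergence
    (fun x => L * (2 * (D * (A + N * B))) *
      ((1 + ‖x‖ ^ (-b)) * (1 + ‖x‖) ^ (-((N : ℝ) + 1)))) ?_ ?_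
    ((integrable_one_add_rpow_div hb0 hb).const_mul _) ?_
  · refine Eventually.of_forall fun s => ?_
    simp_rw [inner_sub_left, inner_add_right]
    exact (((hsum _ _ _).sub (hsum _ _ _)).const_mul _).aestronglyMeasurable
  · filter_upwards [hKn'] with s ⟨hs, hst⟩
    filter_upwards [ae_ne_zero hN] with x hx
    have e1 := hlip s hs t htK x hx
    have e2 : ‖T (sol.u s) x + T (sol.u t) x‖ ≤ 2 * (D * (A + N * B)) * (1 + ‖x‖) ^ m :=
      (norm_add_le _ _).trans (by linarith [hTK s hs x, hTK t htK x])
    have hst' : 0 < |s - t| := abs_pos.2 (sub_ne_zero.2 hst)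
    have h2 : (1 + ‖x‖) ^ (-((N : ℝ) + 1)) = ((1 + ‖x‖) ^ (N + 1))⁻¹ := by
      rw [Real.rpow_neg (by positivity), ← Real.rpow_natCast]; push_cast; rfl
    rw [h2, ← mul_assoc, ← div_eq_mul_inv, le_div_iff₀ (by positivity), norm_mul, norm_inv,
      Real.norm_eq_abs]
    have e3 : ‖inner ℝ (sol.u s x - sol.u t x) (T (sol.u s) x + T (sol.u t) x)‖ ≤
        ‖sol.u s x - sol.u t x‖ * (2 * (D * (A + N * B)) * (1 + ‖x‖) ^ m) :=
      (norm_inner_le_norm _ _).trans (mul_le_mul_of_nonneg_left e2 (norm_nonneg _))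
    generalize ‖inner ℝ (sol.u s x - sol.u t x) (T (sol.u s) x + T (sol.u t) x)‖ = I at e3 ⊢
    generalize ‖sol.u s x - sol.u t x‖ = d at e1 e3
    have hM : 0 ≤ 2 * (D * (A + N * B)) := by positivity
    generalize 2 * (D * (A + N * B)) = M at e3 hM ⊢
    calc |s - t|⁻¹ * I * (1 + ‖x‖) ^ (N + 1)
        ≤ |s - t|⁻¹ * (d * (M * (1 + ‖x‖) ^ m)) * (1 + ‖x‖) ^ (N + 1) := by gcongr
      _ = |s - t|⁻¹ * M * (d * (1 + ‖x‖) ^ (m + (N + 1))) := by rw [pow_add]; ring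
      _ ≤ |s - t|⁻¹ * M * (L * (1 + ‖x‖ ^ (-b)) * |s - t|) := by gcongr
      _ = _ := by field_simp
  · filter_upwards [ae_ne_zero hN] with x hx
    have c1 := hasDerivWithinAt_iff_tendsto_slope.1 (sol.hasDerivWithinAt ht hx)
    have c2 : Tendsto (fun s => T (sol.u s) x) (𝓝[J \ {t}] t) (𝓝 (T (sol.u t) x)) :=
      (hcont x hx t ht).mono_left (nhdsWithin_mono _ sdiff_subset)
    have c3 := c1.inner (𝕜 := ℝ) (c2.add_const (T (sol.u t) x))
    rw [← two_mul, ← Complex.ofReal_ofNat, ← Complex.real_smul, inner_smul_right] at c3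
    refine c3.congr fun s => ?_
    rw [slope_def_module, real_inner_smul_left]

lemma integrable_inner_virialOp {b : ℝ} (hb0 : 0 < b) (hb : b < N) {φ : 𝔼 → ℝ}
    (hφ : Moderate 2 φ) (v w : 𝓢(𝔼, ℂ)) :
    Integrable fun x => inner ℝ (v x) (-2 * Complex.I * virialOp φ w x) := by
  simp_rw [inner_neg_two_I_mul]
  exact (tame_inner_virialOp b hφ _ w).integrable hb0 hb

lemma exists_virialOp_bound {φ : 𝔼 → ℝ} (hφ : Moderate 2 φ) :
    ∃ (C : ℝ) (m : ℕ), 0 ≤ C ∧ ∀ (v : 𝓢(𝔼, ℂ)) x,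
      ‖-2 * Complex.I * virialOp φ v x‖ ≤
        C * (1 + ‖x‖) ^ m * (‖v x‖ + ∑ i, ‖dS i v x‖) := by
  obtain ⟨C, m, hC, h⟩ := ((PolyBdd.sum Finset.univ fun i _ => (hφ.pd i).polyBdd.abs).add
    (Moderate.lapR (n := 0) hφ).polyBdd.abs).bound
  refine ⟨2 * C, m, by positivity, fun v x => ?_⟩
  have hx := (le_abs_self _).trans (h x)
  have hs : ∀ i, |pd i φ x| ≤ ∑ i, |pd i φ x| := fun i =>
    Finset.single_le_sum (f := fun i => |pd i φ x|) (fun _ _ => abs_nonneg _) (Finset.mem_univ i)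
  have hs0 : 0 ≤ ∑ i, |pd i φ x| := Finset.sum_nonneg fun _ _ => abs_nonneg _
  have h1 : ‖virialOp φ v x‖ ≤ C * (1 + ‖x‖) ^ m * (‖v x‖ + ∑ i, ‖dS i v x‖) := by
    rw [virialOp, add_comm, mul_add, Finset.mul_sum]
    refine (norm_add_le _ _).trans (add_le_add ?_ ((norm_sum_le _ _).trans
      (Finset.sum_le_sum fun i _ => ?_))) <;> rw [norm_mul, Complex.norm_real, Real.norm_eq_abs]
    · gcongr
      rw [abs_div, abs_two]
      linarith [abs_nonneg (lapR φ x)]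
    · gcongr
      linarith [abs_nonneg (lapR φ x), hs i]
  rw [norm_mul, norm_mul, norm_neg, Complex.norm_I, Complex.norm_two]
  linarith

lemma inner_I_mul_nonlin (b p : ℝ) (v : 𝓢(𝔼, ℂ)) (x : 𝔼) :
    inner ℝ (Complex.I * nonlin b p v x) (v x) = 0 := by
  rw [nonlin]
  simp only [inner_complex, Complex.mul_re, Complex.mul_im, Complex.ofReal_re, Complex.ofReal_im,
    Complex.I_re, Complex.I_im]
  ring

lemma inner_ofReal_mul (c : ℝ) (z w : ℂ) : inner ℝ z ((c : ℂ) * w) = c * inner ℝ z w := by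
  simp only [inner_complex, Complex.re_ofReal_mul, Complex.im_ofReal_mul]; ring

lemma INLSSolution.hasDerivWithinAt_virial {b p : ℝ} (hN : 1 ≤ N) (hb0 : 0 < b) (hb : b < N)
    (hp : 1 < p) {J : Set ℝ} (hJ : J.OrdConnected) (sol : INLSSolution N b p J) {φ : 𝔼 → ℝ}
    (hφ : Moderate 2 φ) {t : ℝ} (ht : t ∈ J) :
    HasDerivWithinAt (fun s => ∫ x, φ x * ‖sol.u s x‖ ^ 2)
      (∫ x, inner ℝ (sol.u t x) (-2 * Complex.I * virialOp φ (sol.u t) x)) J t := by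
  have h := sol.hasDerivWithinAt_integral hN hb0 hb hp hJ (T := fun v x => (φ x : ℂ) * v x)
    (fun v w => by
      simp_rw [inner_ofReal_mul]
      exact (Tame.polyMul hφ.polyBdd (tame_inner b v w)).integrable hb0 hb)
    (fun v w => by simp_rw [inner_ofReal_mul, real_inner_comm])
    (by
      obtain ⟨C, m, hC, h⟩ := hφ.polyBdd.bound
      refine ⟨C, m, hC, fun v x => ?_⟩
      rw [norm_mul, Complex.norm_real, Real.norm_eq_abs]
      exact mul_le_mul (h x) (le_add_of_nonneg_right
        (Finset.sum_nonneg fun _ _ => norm_nonneg _)) (norm_nonneg _) (by positivity))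
    (fun x hx s hs => continuousWithinAt_const.mul
      (sol.hasDerivWithinAt hs hx).continuousWithinAt) ht
  convert! h using 1
  · ext s
    simp_rw [inner_ofReal_mul, real_inner_self_eq_norm_sq]
  · rw [← integral_inner_I_lap hb0 hb hφ]
    refine integral_congr_ae (Eventually.of_forall fun x => ?_)
    simp only [timeDeriv, mul_add, inner_add_left, inner_ofReal_mul, inner_I_mul_nonlin, mul_zero,
      add_zero]

lemma INLSSolution.hasDerivWithinAt_momentum {b p : ℝ} (hN : 1 ≤ N) (hb0 : 0 < b) (hb : b < N)
    (hp : 1 < p) {J : Set ℝ} (hJ : J.OrdConnected) (sol : INLSSolution N b p J) {φ : 𝔼 → ℝ}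
    (hφ : Moderate 4 φ) (hκ : PolyBdd (radialCoeff φ)) {t : ℝ} (ht : t ∈ J) :
    HasDerivWithinAt
      (fun s => ∫ x, inner ℝ (sol.u s x) (-2 * Complex.I * virialOp φ (sol.u s) x))
      ((∫ x, (4 * (∑ j, ∑ k, pd j (pd k φ) x *
          inner ℝ (dS j (sol.u t) x) (dS k (sol.u t) x)) -
          lapR (lapR φ) x * ‖sol.u t x‖ ^ 2)) +
        ∫ x, -(2 * (p - 1) / (p + 1)) * ((lapR φ x + 2 * b / (p - 1) * radialCoeff φ x) *
          (‖x‖ ^ (-b) * ‖sol.u t x‖ ^ (p + 1)))) J t := by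
  have hφ2 : Moderate 2 φ := hφ.mono (by norm_num)
  have h := sol.hasDerivWithinAt_integral hN hb0 hb hp hJ
    (T := fun v x => -2 * Complex.I * virialOp φ v x)
    (fun v w => integrable_inner_virialOp hb0 hb hφ2 v w)
    (fun v w => virialOp_symm hb0 hb hφ2 v w) (exists_virialOp_bound hφ2)
    (fun x hx => by
      have h0 : ContinuousOn (fun s => sol.u s x) J :=
        fun s hs => (sol.hasDerivWithinAt hs hx).continuousWithinAt
      have h1 := fun i => sol.continuousOn_dS hJ i hx
      unfold virialOp
      fun_prop) ht
  convert! h using 1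
  rw [← integral_inner_lap_virialOp hb0 hb hφ, ← integral_inner_nonlin_virialOp hN hb0 hb hp hφ2 hκ,
    ← integral_add]
  · refine integral_congr_ae (Eventually.of_forall fun x => ?_)
    simp only [timeDeriv, ← mul_add, ← inner_add_left]
    generalize lap (sol.u t) x + nonlin b p (sol.u t) x = z
    simp only [inner_complex, Complex.mul_re, Complex.mul_im, Complex.I_re, Complex.I_im,
      Complex.neg_re, Complex.neg_im, Complex.re_ofNat, Complex.im_ofNat]
    ring
  · rw [lap_eq_sum]
    exact ((tame_inner_virialOp b hφ2 _ _).constMul _).integrable hb0 hb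
  · exact ((tame_inner_nonlin_virialOp hp hφ2 _).constMul _).integrable hb0 hb

end Virial

/-- Radial form of the second derivative of the localized virial quantity:
for a classical Schwartz solution of (INLS) on an interval `J` and a radial `C⁴` weight
`φ(x) = w(|x|)` with polynomially bounded derivatives up to order 4 (writing `r = |x|`),
`I(t) = ∫ φ|u(t,·)|² dx` is twice differentiable with
`I''(t) = 4∫ (w'(r)/r)|∇u|² + 4∫ (w''(r)/r² − w'(r)/r³)|x·∇u|²
 − (2(p−1)/(p+1)) ∫ [w''(r) + (N−1+2b/(p−1)) w'(r)/r] |x|^{-b}|u|^{p+1} − ∫ Δ²φ |u|²`. -/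
theorem stmt13 (N : ℕ) (hN : 1 ≤ N) (b p : ℝ) (hb1 : 0 < b) (hb2 : b < min 2 (N : ℝ))
    (hp : 1 < p) (J : Set ℝ) (hJ : J.OrdConnected) (sol : INLSSolution N b p J)
    (w : ℝ → ℝ)
    (hφ : ContDiff ℝ 4 (fun x : EuclideanSpace ℝ (Fin N) => w ‖x‖))
    (hgrowth : ∃ (C : ℝ) (m : ℕ), ∀ x : EuclideanSpace ℝ (Fin N), ∀ k : ℕ, k ≤ 4 →
      ‖iteratedFDeriv ℝ k (fun y : EuclideanSpace ℝ (Fin N) => w ‖y‖) x‖ ≤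
        C * (1 + ‖x‖) ^ m) :
    ∃ I' : ℝ → ℝ,
      (∀ t ∈ J,
        HasDerivWithinAt
          (fun s => ∫ x : EuclideanSpace ℝ (Fin N), w ‖x‖ * ‖sol.u s x‖ ^ 2) (I' t) J t) ∧
      (∀ t ∈ J,
        HasDerivWithinAt I'
          (4 * (∫ x : EuclideanSpace ℝ (Fin N),
              (deriv w ‖x‖ / ‖x‖) * gradNormSq (fun y => sol.u t y) x) +
            4 * (∫ x : EuclideanSpace ℝ (Fin N),
              (deriv (deriv w) ‖x‖ / ‖x‖ ^ 2 - deriv w ‖x‖ / ‖x‖ ^ 3) *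
                ‖∑ i : Fin N,
                    (x i : ℂ) *
                      fderiv ℝ (fun y => sol.u t y) x (EuclideanSpace.single i 1)‖ ^ 2) -
            (2 * (p - 1) / (p + 1)) *
              (∫ x : EuclideanSpace ℝ (Fin N),
                (deriv (deriv w) ‖x‖ +
                    ((N : ℝ) - 1 + 2 * b / (p - 1)) * (deriv w ‖x‖ / ‖x‖)) *
                  (‖x‖ ^ (-b) * ‖sol.u t x‖ ^ (p + 1))) -
            ∫ x : EuclideanSpace ℝ (Fin N),
              lapR (lapR (fun y : EuclideanSpace ℝ (Fin N) => w ‖y‖)) x * ‖sol.u t x‖ ^ 2)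
          J t) := by
  have hb : b < N := hb2.trans_le (min_le_right _ _)
  set φ : EuclideanSpace ℝ (Fin N) → ℝ := fun x => w ‖x‖ with hφdef
  have hM : Moderate 4 φ := ⟨hφ, hgrowth⟩
  have hM2 : Moderate 2 φ := hM.mono (by norm_num)
  have hκ : PolyBdd (radialCoeff φ) :=
    polyBdd_radialCoeff hM2 (fderiv_zero_of_even
      (hM2.differentiable (n := 1) 0) fun x => by simp [hφdef])
  refine ⟨fun t => ∫ x, inner ℝ (sol.u t x) (-2 * Complex.I * virialOp φ (sol.u t) x),
    fun t ht => sol.hasDerivWithinAt_virial hN hb1 hb hp hJ hM2 ht, fun t ht => ?_⟩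
  convert! sol.hasDerivWithinAt_momentum hN hb1 hb hp hJ hM hκ ht using 1
  set v := sol.u t
  have hG : ∀ᵐ x, radialCoeff φ x * ∑ i, inner ℝ (dS i v x) (dS i v x) =
      (deriv w ‖x‖ / ‖x‖) * gradNormSq (fun y => v y) x := by
    filter_upwards [ae_ne_zero hN] with x hx
    simp_rw [real_inner_self_eq_norm_sq]
    rw [radialCoeff_radial hφ hx]
    rfl
  have hGi : Integrable fun x => (deriv w ‖x‖ / ‖x‖) * gradNormSq (fun y => v y) x :=
    ((Tame.polyMul hκ (Tame.sum _ fun i _ => tame_inner b _ _)).integrable hb1 hb).congr hG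
  have hHi : Integrable fun x => ∑ j, ∑ k, pd j (pd k φ) x * inner ℝ (dS j v x) (dS k v x) :=
    (Tame.sum _ fun j _ => Tame.sum _ fun k _ => Tame.polyMul
      ((hM2.pd (n := 1) k).pd (n := 0) j).polyBdd (tame_inner b _ _)).integrable hb1 hb
  have hH : ∀ᵐ x, ∑ j, ∑ k, pd j (pd k φ) x * inner ℝ (dS j v x) (dS k v x) =
      (deriv w ‖x‖ / ‖x‖) * gradNormSq (fun y => v y) x +
        (deriv (deriv w) ‖x‖ / ‖x‖ ^ 2 - deriv w ‖x‖ / ‖x‖ ^ 3) *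
          ‖∑ i : Fin N, (x i : ℂ) *
            fderiv ℝ (fun y => v y) x (EuclideanSpace.single i 1)‖ ^ 2 := by
    filter_upwards [ae_ne_zero hN] with x hx
    exact hessian_radial hφ hx fun i => dS i v x
  have hRi : Integrable fun x : EuclideanSpace ℝ (Fin N) =>
      (deriv (deriv w) ‖x‖ / ‖x‖ ^ 2 - deriv w ‖x‖ / ‖x‖ ^ 3) *
        ‖∑ i : Fin N, (x i : ℂ) *
          fderiv ℝ (fun y => v y) x (EuclideanSpace.single i 1)‖ ^ 2 := by
    refine (hHi.sub hGi).congr ?_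
    filter_upwards [hH] with x hx
    rw [Pi.sub_apply, hx, add_sub_cancel_left]
  have hBi : Integrable fun x => lapR (lapR φ) x * ‖v x‖ ^ 2 := by
    simp_rw [← real_inner_self_eq_norm_sq]
    exact (Tame.polyMul (Moderate.lapR (n := 0) (Moderate.lapR (n := 2) hM)).polyBdd
      (tame_inner b _ _)).integrable hb1 hb
  rw [integral_sub (hHi.const_mul 4) hBi, integral_const_mul, integral_congr_ae hH,
    integral_add hGi hRi, integral_const_mul]
  have hP : ∀ᵐ x : EuclideanSpace ℝ (Fin N),
      (lapR φ x + 2 * b / (p - 1) * radialCoeff φ x) * (‖x‖ ^ (-b) * ‖v x‖ ^ (p + 1)) =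
      (deriv (deriv w) ‖x‖ + ((N : ℝ) - 1 + 2 * b / (p - 1)) * (deriv w ‖x‖ / ‖x‖)) *
        (‖x‖ ^ (-b) * ‖v x‖ ^ (p + 1)) := by
    filter_upwards [ae_ne_zero hN] with x hx
    rw [lapR_radial hφ hx, radialCoeff_radial hφ hx]
    ring
  rw [integral_congr_ae hP]
  ring
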